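/- arXiv:1502.06513 — 2 statements merged into one kernel-verified Lean document; each statement's English description precedes it below -/
import Mathlib

section
/- Let n ≥ 2, 0 < τ ≤ 1/2, and fix t' with 1/2 ≤ t' ≤ 1 − τ/2; set t'' := 1 − t', and for y₁, y₂ ∈ ℝ^{n−1} write y₁₂' := t'y₁ + t''y₂ and y₁₂'' := t''y₁ + t'y₂. Let σ, ς > 0, M̂ ≥ 1, let F ⊆ ℝ^{n−1}, and let ψ : F → ℝ satisfy: (i) ψ(y₁) + ψ(y₂) ≤ ψ(y₁₂') + ψ(y₁₂'') + σ whenever y₁, y₂, y₁₂', y₁₂'' ∈ F; (ii) with Ω := co(F), H^{n−1}(Ω \ F) ≤ ς; (iii) B_r ⊆ Ω ⊆ B_{(n−1)r} for some r with 1/n < r < n; (iv) −M̂ ≤ ψ(y) ≤ M̂ for all y ∈ F; and (v) there exists a set H ⊆ ℝ such that ∫_H H^{n−1}(co({ψ > s}) \ {ψ > s}) ds + ∫_{ℝ\H} H^{n−1}({ψ > s}) ds ≤ ς. Then, with β_{n,τ} := τ/(16(n−1)|log τ|), there exist a concave function Ψ : Ω → [−2M̂, 2M̂] and a constant L'_n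 depending only on n such that ∫_F |Ψ(y) − ψ(y)| dy ≤ τ^{−L'_n} M̂ (σ + ς)^{β_{n,τ}}. -/
open MeasureTheory Set Pointwise
open scoped ENNReal

section HU
variable {E : Type*} [NormedAddCommGroup E] [NormedSpace ℝ E]

lemma hu_two {Ω : Set E} (hΩ : Convex ℝ Ω) {u : E → ℝ} {M e : ℝ}
    (hb : ∀ x ∈ Ω, |u x| ≤ M)
    (hmid : ∀ x ∈ Ω, ∀ y ∈ Ω, u x + u y ≤ 2 * u ((1/2:ℝ) • x + (1/2:ℝ) • y) + e)
    (he : 0 ≤ e) {x y : E} (hx : x ∈ Ω) (hy : y ∈ Ω) {t : ℝ} (ht0 : 0 ≤ t) (ht1 : t ≤ 1) :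
    (1 - t) * u x + t * u y ≤ u ((1 - t) • x + t • y) + e := by
  have key : ∀ j : ℕ, ∀ t : ℝ, 0 ≤ t → t ≤ 1 →
      (1 - t) * u x + t * u y ≤ u ((1 - t) • x + t • y) + e + 2 * M / 2 ^ j := by
    intro j
    induction j with
    | zero =>
      intro t h0 h1
      have hp : (1 - t) • x + t • y ∈ Ω := hΩ hx hy (by linarith) h0 (by ring)
      have h1' := abs_le.1 (hb _ hx)
      have h2' := abs_le.1 (hb _ hy)
      have h3' := abs_le.1 (hb _ hp)
      simp only [pow_zero, div_one]
      nlinarith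
    | succ j ih =>
      intro t h0 h1
      have hdiv : 2 * M / 2 ^ (j+1) = (2 * M / 2 ^ j) / 2 := by
        rw [pow_succ]; field_simp
      rw [hdiv]
      rcases le_total t (1/2) with h | h
      · have hp : (1 - 2*t) • x + (2*t) • y ∈ Ω := hΩ hx hy (by linarith) (by linarith) (by ring)
        have h1 := hmid _ hx _ hp
        have h2 := ih (2*t) (by linarith) (by linarith)
        have h3 : (1/2:ℝ) • x + (1/2:ℝ) • ((1 - 2*t) • x + (2*t) • y) = (1 - t) • x + t • y := by
          module
        rw [h3] at h1
        linarith
      · have hp : (1 - (2*t-1)) • x + (2*t-1) • y ∈ Ω :=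
          hΩ hx hy (by linarith) (by linarith) (by ring)
        have h1 := hmid _ hy _ hp
        have h2 := ih (2*t-1) (by linarith) (by linarith)
        have h3 : (1/2:ℝ) • y + (1/2:ℝ) • ((1 - (2*t-1)) • x + (2*t-1) • y)
            = (1 - t) • x + t • y := by
          module
        rw [h3] at h1
        linarith
  have hlim : Filter.Tendsto (fun j : ℕ => u ((1 - t) • x + t • y) + e + 2 * M / 2 ^ j)
      Filter.atTop (nhds (u ((1 - t) • x + t • y) + e + 0)) := by
    refine Filter.Tendsto.const_add _ ?_
    have := (tendsto_pow_atTop_nhds_zero_of_lt_one (r := (1/2:ℝ)) (by norm_num)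
      (by norm_num)).const_mul (2*M)
    simp only [mul_zero] at this
    refine this.congr fun j => ?_
    rw [one_div, inv_pow, div_eq_mul_inv]
  have := ge_of_tendsto' hlim (fun j => key j t ht0 ht1)
  linarith

lemma hu_fin {ι : Type*} {Ω : Set E} (hΩ : Convex ℝ Ω) {u : E → ℝ} {e : ℝ} (he : 0 ≤ e)
    (htwo : ∀ x ∈ Ω, ∀ y ∈ Ω, ∀ t : ℝ, 0 ≤ t → t ≤ 1 →
      (1 - t) * u x + t * u y ≤ u ((1 - t) • x + t • y) + e) (z : ι → E) (hz : ∀ i, z i ∈ Ω)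
    (s : Finset ι) : ∀ (w : ι → ℝ), (∀ i ∈ s, 0 ≤ w i) → ∑ i ∈ s, w i = 1 →
      ∑ i ∈ s, w i * u (z i) ≤ u (∑ i ∈ s, w i • z i) + s.card * e := by
  classical
  induction s using Finset.induction_on with
  | empty => intro w _ h; simp at h
  | insert a s ha ih =>
    intro w hw hsum
    rw [Finset.sum_insert ha] at hsum
    rw [Finset.sum_insert ha, Finset.sum_insert ha, Finset.card_insert_of_notMem ha]
    have hwa : 0 ≤ w a := hw a (Finset.mem_insert_self _ _)
    have hws : ∀ i ∈ s, 0 ≤ w i := fun i hi => hw i (Finset.mem_insert_of_mem hi)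
    have hW0 : 0 ≤ ∑ i ∈ s, w i := Finset.sum_nonneg hws
    set W := ∑ i ∈ s, w i with hW
    rcases hW0.eq_or_lt with h | h
    · have hz0 : ∀ i ∈ s, w i = 0 := (Finset.sum_eq_zero_iff_of_nonneg hws).1 h.symm
      have h1 : ∑ i ∈ s, w i * u (z i) = 0 :=
        Finset.sum_eq_zero fun i hi => by rw [hz0 i hi, zero_mul]
      have h2 : ∑ i ∈ s, w i • z i = 0 :=
        Finset.sum_eq_zero fun i hi => by rw [hz0 i hi, zero_smul]
      have h3 : w a = 1 := by linarith
      rw [h1, h2, h3, one_smul, add_zero, one_mul, add_zero]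
      have : 0 ≤ ((s.card + 1 : ℕ) : ℝ) * e := by positivity
      linarith
    · have hih := ih (fun i => w i / W) (fun i hi => div_nonneg (hws i hi) hW0)
        (by rw [← Finset.sum_div]; exact div_self h.ne')
      set p := ∑ i ∈ s, (w i / W) • z i with hp
      have hpΩ : p ∈ Ω := hΩ.sum_mem (fun i hi => div_nonneg (hws i hi) hW0)
        (by rw [← Finset.sum_div]; exact div_self h.ne') (fun i _ => hz i)
      have h2 := htwo _ (hz a) _ hpΩ W hW0 (by linarith)
      have h3 : ∑ i ∈ s, w i • z i = W • p := by
        rw [hp, Finset.smul_sum]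
        refine Finset.sum_congr rfl fun i _ => ?_
        rw [smul_smul, mul_div_cancel₀ _ h.ne']
      have h4 : ∑ i ∈ s, w i * u (z i) = W * ∑ i ∈ s, (w i / W) * u (z i) := by
        rw [Finset.mul_sum]
        refine Finset.sum_congr rfl fun i _ => ?_
        field_simp
      have h5 : w a = 1 - W := by linarith
      rw [h3, h4, h5]
      have h6 : W * ∑ i ∈ s, (w i / W) * u (z i) ≤ W * (u p + s.card * e) :=
        mul_le_mul_of_nonneg_left hih hW0
      have h7 : W * (s.card * e) ≤ 1 * (s.card * e) :=
        mul_le_mul_of_nonneg_right (by linarith) (by positivity)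
      push_cast
      nlinarith

lemma hyers_ulam [FiniteDimensional ℝ E] {Ω : Set E} (hΩ : Convex ℝ Ω) {u : E → ℝ} {M e : ℝ}
    (hb : ∀ x ∈ Ω, |u x| ≤ M)
    (hmid : ∀ x ∈ Ω, ∀ y ∈ Ω, u x + u y ≤ 2 * u ((1/2:ℝ) • x + (1/2:ℝ) • y) + e)
    (he : 0 ≤ e) :
    ∃ Ψ : E → ℝ, ConcaveOn ℝ Ω Ψ ∧ (∀ y ∈ Ω, |Ψ y| ≤ M) ∧
      ∀ y ∈ Ω, |Ψ y - u y| ≤ (Module.finrank ℝ E + 2) * e := by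
  set G : Set (E × ℝ) := (fun x => (x, u x)) '' Ω with hG
  set C := convexHull ℝ G with hC
  have hCM : ∀ p ∈ C, p.2 ≤ M := by
    have hc : Convex ℝ {p : E × ℝ | p.2 ≤ M} :=
      convex_halfSpace_le (f := fun p : E × ℝ => p.2) ⟨fun _ _ => rfl, fun _ _ => rfl⟩ M
    have : C ⊆ {p : E × ℝ | p.2 ≤ M} := convexHull_min (by
      rintro _ ⟨x, hx, rfl⟩; exact (abs_le.1 (hb x hx)).2) hc
    exact fun p hp => this hp
  have hCu : ∀ p ∈ C, p.2 ≤ u p.1 + (Module.finrank ℝ E + 2) * e := by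
    intro p hp
    obtain ⟨ι, _, z, w, hzG, hind, hw, hsum, rfl⟩ := eq_pos_convex_span_of_mem_convexHull hp
    have hz : ∀ i, (z i).1 ∈ Ω ∧ (z i).2 = u (z i).1 := by
      intro i
      obtain ⟨x, hx, h⟩ := hzG ⟨i, rfl⟩
      rw [← h]; exact ⟨hx, rfl⟩
    have h1 := hu_fin hΩ he (fun x hx y hy t h0 h1 => hu_two hΩ hb hmid he hx hy h0 h1)
      (fun i => (z i).1) (fun i => (hz i).1) Finset.univ w (fun i _ => (hw i).le) hsum
    have hcard : (Finset.univ : Finset ι).card ≤ Module.finrank ℝ E + 2 := by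
      rw [Finset.card_univ]
      have h2 := hind.card_le_finrank_succ
      have h3 := Submodule.finrank_le (vectorSpan ℝ (range z))
      rw [Module.finrank_prod, Module.finrank_self] at h3
      omega
    have hcard' : ((Finset.univ : Finset ι).card : ℝ) ≤ Module.finrank ℝ E + 2 := by
      exact_mod_cast hcard
    rw [Prod.fst_sum, Prod.snd_sum]
    simp only [Prod.smul_fst, Prod.smul_snd, smul_eq_mul]
    have h4 : ∑ i, w i * (z i).2 = ∑ i, w i * u (z i).1 :=
      Finset.sum_congr rfl fun i _ => by rw [(hz i).2]
    rw [h4]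
    have := mul_le_mul_of_nonneg_right hcard' he
    linarith
  have hmem : ∀ x ∈ Ω, (x, u x) ∈ C := fun x hx => subset_convexHull _ _ ⟨x, hx, rfl⟩
  set Ψ : E → ℝ := fun x => sSup {s | (x, s) ∈ C} with hΨ
  have hbdd : ∀ x, BddAbove {s | (x, s) ∈ C} := fun x => ⟨M, fun s hs => hCM _ hs⟩
  have hlow : ∀ x ∈ Ω, u x ≤ Ψ x := fun x hx => le_csSup (hbdd x) (hmem x hx)
  have hup : ∀ x ∈ Ω, ∀ b, (∀ s, (x, s) ∈ C → s ≤ b) → Ψ x ≤ b := fun x hx b h =>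
    csSup_le ⟨_, hmem x hx⟩ h
  refine ⟨Ψ, ⟨hΩ, ?_⟩, ?_, ?_⟩
  · intro x hx y hy a b ha hb' hab
    refine le_of_forall_pos_le_add fun ε hε => ?_
    obtain ⟨s, hs, hs'⟩ := exists_lt_of_lt_csSup (s := {s | (x, s) ∈ C}) ⟨_, hmem x hx⟩
      (show Ψ x - ε < Ψ x by linarith)
    obtain ⟨s2, hs2, hs2'⟩ := exists_lt_of_lt_csSup (s := {s | (y, s) ∈ C}) ⟨_, hmem y hy⟩
      (show Ψ y - ε < Ψ y by linarith)
    have h := convex_convexHull ℝ G hs hs2 ha hb' hab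
    have h2 : a • s + b • s2 ≤ Ψ (a • x + b • y) := le_csSup (hbdd _) h
    simp only [smul_eq_mul] at h2 ⊢
    have h3 : a * (Ψ x - ε) ≤ a * s := mul_le_mul_of_nonneg_left hs'.le ha
    have h4 : b * (Ψ y - ε) ≤ b * s2 := mul_le_mul_of_nonneg_left hs2'.le hb'
    have h5 : a * ε + b * ε = ε := by rw [← add_mul, hab, one_mul]
    linarith
  · intro y hy
    rw [abs_le]
    exact ⟨(abs_le.1 (hb y hy)).1.trans (hlow y hy), hup y hy _ fun s hs => hCM _ hs⟩
  · intro y hy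
    rw [abs_of_nonneg (by linarith [hlow y hy])]
    have := hup y hy (u y + (Module.finrank ℝ E + 2) * e) fun s hs => hCu _ hs
    linarith

end HU

section HOM
variable {E : Type*} [NormedAddCommGroup E] [NormedSpace ℝ E] [FiniteDimensional ℝ E]
  [MeasurableSpace E] [BorelSpace E] (μ : Measure E) [μ.IsAddHaarMeasure]

lemma hom_pack {a : ℝ} (ha0 : 0 < a) (ha1 : a ≤ 1) {z : E} {B D : Set E}
    (hB : Convex ℝ B) (hz : z ∈ B) (hD : MeasurableSet D)
    (hDB : D ⊆ B)
    (hdis : ∀ x ∈ D, ∀ k : ℕ, 1 ≤ k → AffineMap.homothety z (a ^ k) x ∉ D) (N : ℕ) :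
    (N : ℝ≥0∞) * (ENNReal.ofReal ((a ^ N) ^ Module.finrank ℝ E) * μ D) ≤ μ B := by
  have := FiniteDimensional.proper ℝ E
  have : CompleteSpace E := FiniteDimensional.complete ℝ E
  have hpos : ∀ j : ℕ, 0 < a ^ j := fun j => pow_pos ha0 j
  have hle1 : ∀ j : ℕ, a ^ j ≤ 1 := fun j => pow_le_one₀ ha0.le ha1
  set A : ℕ → Set E := fun j => AffineMap.homothety z (a ^ j) '' D with hA
  have hinj : ∀ j : ℕ, Function.Injective (AffineMap.homothety z (a ^ j) : E → E) := by
    intro j x y h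
    simp only [AffineMap.homothety_apply, vsub_eq_sub, vadd_eq_add, add_left_inj] at h
    have := smul_right_injective E (hpos j).ne' h
    simpa using this
  have hcont : ∀ j : ℕ, Continuous (AffineMap.homothety z (a ^ j) : E → E) := fun j =>
    AffineMap.homothety_continuous z _
  have hmeas : ∀ j, MeasurableSet (A j) := fun j =>
    hD.image_of_continuousOn_injOn (hcont j).continuousOn (hinj j).injOn
  have hdisj' : ∀ i j : ℕ, i < j → Disjoint (A i) (A j) := by
    intro i j hij
    rw [Set.disjoint_left]
    rintro _ ⟨x, hx, rfl⟩ ⟨y, hy, h⟩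
    obtain ⟨k, rfl⟩ := Nat.exists_eq_add_of_lt hij
    have h2 : AffineMap.homothety z (a ^ (i + k + 1)) y =
        AffineMap.homothety z (a ^ i) (AffineMap.homothety z (a ^ (k+1)) y) := by
      rw [← AffineMap.homothety_mul_apply, ← pow_add, add_assoc]
    rw [h2] at h
    have h3 := hinj i h
    exact hdis y hy (k+1) (by omega) (h3 ▸ hx)
  have hpd : Pairwise (Function.onFun Disjoint A) := by
    intro i j hij
    rcases lt_or_gt_of_ne hij with h | h
    · exact hdisj' i j h
    · exact (hdisj' j i h).symm
  have hsub : (⋃ j ∈ Finset.range N, A j) ⊆ B := by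
    refine iUnion₂_subset fun j _ => ?_
    rintro _ ⟨x, hx, rfl⟩
    rw [AffineMap.homothety_eq_lineMap]
    exact hB.lineMap_mem hz (hDB hx) ⟨(hpos j).le, hle1 j⟩
  have h1 := measure_biUnion_finset (μ := μ) (s := Finset.range N) (f := A)
    (fun i _ j _ hij => hpd hij) (fun j _ => hmeas j)
  calc (N : ℝ≥0∞) * (ENNReal.ofReal ((a ^ N) ^ Module.finrank ℝ E) * μ D)
      = ∑ j ∈ Finset.range N, ENNReal.ofReal ((a ^ N) ^ Module.finrank ℝ E) * μ D := by
        simp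
    _ ≤ ∑ j ∈ Finset.range N, μ (A j) := by
        refine Finset.sum_le_sum fun j hj => ?_
        rw [hA, Measure.addHaar_image_homothety]
        gcongr
        rw [abs_of_nonneg (by have := hpos j; positivity)]
        refine pow_le_pow_left₀ (hpos N).le ?_ _
        exact pow_le_pow_of_le_one ha0.le ha1 (Finset.mem_range.1 hj).le
    _ = μ (⋃ j ∈ Finset.range N, A j) := h1.symm
    _ ≤ μ B := measure_mono hsub

lemma hom_mem {K : Set E} (hK : Convex ℝ K) {z x : E} {p q s : ℝ} (hpq : p ≤ q) (hqs : q ≤ s)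
    (hp : AffineMap.homothety z p x ∈ K) (hs : AffineMap.homothety z s x ∈ K) :
    AffineMap.homothety z q x ∈ K := by
  rw [AffineMap.homothety_eq_lineMap] at *
  have := (hK.affine_preimage (AffineMap.lineMap z x : ℝ →ᵃ[ℝ] E)).ordConnected
  exact this.out hp hs ⟨hpq, hqs⟩

lemma hom_pack' {l : ℝ} (hl0 : 0 < l) (hl1 : l ≤ 1/2) {z : E} {B D : Set E}
    (hB : Convex ℝ B) (hz : z ∈ B) (hD : MeasurableSet D)
    (hDB : D ⊆ B)
    (hdis : ∀ x ∈ D, ∀ k : ℕ, 1 ≤ k → AffineMap.homothety z ((1-l) ^ k) x ∉ D) :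
    μ D ≤ ENNReal.ofReal (4 * 2 ^ Module.finrank ℝ E * l) * μ B := by
  set d := Module.finrank ℝ E
  set N := ⌊1/(2*l)⌋₊ with hN
  have h1 : 1 ≤ 1/(2*l) := by rw [le_div_iff₀ (by positivity)]; linarith
  have hN1 : (N:ℝ) ≤ 1/(2*l) := Nat.floor_le (by positivity)
  have hN1' : 1 ≤ N := by rw [hN, Nat.one_le_floor_iff]; exact h1
  have hN2 : 1/(4*l) ≤ N := by
    have h2 : 1/(2*l) < N + 1 := Nat.lt_floor_add_one _
    have h3 : (1:ℝ) ≤ N := by exact_mod_cast hN1'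
    have h4 : 1/(4*l) = (1/(2*l))/2 := by field_simp; norm_num
    rw [h4]; linarith
  have hbern : 1/2 ≤ (1-l)^N := by
    have := one_add_mul_le_pow (a := -l) (by linarith) N
    have h5 : N * l ≤ 1/2 := by
      have := mul_le_mul_of_nonneg_right hN1 hl0.le
      have h6 : 1/(2*l)*l = 1/2 := by field_simp
      linarith
    have h7 : 1 + -l = 1 - l := by ring
    rw [h7] at this
    linarith
  have hpack := hom_pack μ (a := 1-l) (by linarith) (by linarith) hB hz hD hDB hdis N
  have hc : ENNReal.ofReal (1/(4*l) * (1/2)^d) * μ D ≤ μ B := by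
    refine le_trans ?_ hpack
    rw [← mul_assoc, ENNReal.ofReal_mul (by positivity)]
    gcongr
    rw [← ENNReal.ofReal_natCast]
    exact ENNReal.ofReal_le_ofReal hN2
  calc μ D = ENNReal.ofReal (4 * 2 ^ d * l) * (ENNReal.ofReal (1/(4*l) * (1/2)^d) * μ D) := by
        rw [← mul_assoc, ← ENNReal.ofReal_mul (by positivity)]
        have : 4 * 2 ^ d * l * (1 / (4 * l) * (1 / 2) ^ d) = 1 := by
          rw [one_div_pow]; field_simp
        rw [this]; simp
    _ ≤ _ := by gcongr

lemma hom_diff {l : ℝ} (hl0 : 0 < l) (hl1 : l ≤ 1/2) {z : E} {B K : Set E}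
    (hB : Convex ℝ B) (hBm : MeasurableSet B) (hz : z ∈ B) (hK : Convex ℝ K)
    (hKm : MeasurableSet K) :
    μ {y ∈ B | ¬ (y ∈ K ↔ AffineMap.homothety z (1-l) y ∈ K)} ≤
      ENNReal.ofReal (8 * 2 ^ Module.finrank ℝ E * l) * μ B := by
  have hcm : Measurable (AffineMap.homothety z (1-l) : E → E) :=
    (AffineMap.homothety_continuous z _).measurable
  set D1 := {y ∈ B | y ∈ K ∧ AffineMap.homothety z (1-l) y ∉ K} with hD1
  set D2 := {y ∈ B | y ∉ K ∧ AffineMap.homothety z (1-l) y ∈ K} with hD2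
  have hm1 : MeasurableSet D1 := hBm.inter (hKm.inter (hcm hKm).compl)
  have hm2 : MeasurableSet D2 := hBm.inter (hKm.compl.inter (hcm hKm))
  have hpow : ∀ k : ℕ, 1 ≤ k → (1-l)^k ≤ 1 - l := fun k hk => by
    calc (1-l)^k ≤ (1-l)^1 := pow_le_pow_of_le_one (by linarith) (by linarith) hk
      _ = 1-l := pow_one _
  have h1 := hom_pack' μ hl0 hl1 hB hz hm1 (fun x hx => hx.1) (by
    rintro x ⟨_, hxK, hx⟩ k hk ⟨_, hk2, _⟩
    refine hx (hom_mem hK (hpow k hk) (by linarith : 1 - l ≤ 1) hk2 ?_)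
    simpa using hxK)
  have h2 := hom_pack' μ hl0 hl1 hB hz hm2 (fun x hx => hx.1) (by
    rintro x ⟨_, hxK, hx⟩ k hk ⟨_, hk2, hk3⟩
    rw [← AffineMap.homothety_mul_apply] at hk3
    refine hk2 (hom_mem hK ?_ (hpow k hk) hk3 hx)
    have : 0 < (1-l)^k := pow_pos (by linarith) k
    nlinarith)
  have hsub : {y ∈ B | ¬ (y ∈ K ↔ AffineMap.homothety z (1-l) y ∈ K)} ⊆ D1 ∪ D2 := by
    rintro y ⟨hy, hn⟩
    by_cases h : y ∈ K
    · left; exact ⟨hy, h, fun h' => hn ⟨fun _ => h', fun _ => h⟩⟩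
    · right; exact ⟨hy, h, by by_contra h'; exact hn ⟨fun a => absurd a h, fun a => absurd a h'⟩⟩
  calc _ ≤ μ (D1 ∪ D2) := measure_mono hsub
    _ ≤ μ D1 + μ D2 := measure_union_le _ _
    _ ≤ _ := add_le_add h1 h2
    _ = _ := by
      rw [← add_mul, ← ENNReal.ofReal_add (by positivity) (by positivity)]
      congr 2; ring
end HOM

section MOL
variable {E : Type*} [NormedAddCommGroup E] [NormedSpace ℝ E] [FiniteDimensional ℝ E]
  [MeasurableSpace E] [BorelSpace E] (μ : Measure E) [μ.IsAddHaarMeasure]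

lemma real_ball (x : E) {r : ℝ} (hr : 0 < r) :
    μ.real (Metric.ball x r) = r ^ Module.finrank ℝ E * μ.real (Metric.ball 0 1) := by
  rw [Measure.real, Measure.addHaar_ball_of_pos μ x hr, ENNReal.toReal_mul,
    ENNReal.toReal_ofReal (by positivity)]
  rfl

lemma real_ball_pos (x : E) {r : ℝ} (hr : 0 < r) : 0 < μ.real (Metric.ball x r) :=
  ENNReal.toReal_pos (Metric.measure_ball_pos μ x hr).ne' (by
    have := FiniteDimensional.proper ℝ E
    exact measure_ball_lt_top.ne)

lemma bdd_intOn {F : E → ℝ} (hF : Measurable F) {M : ℝ} (hM : ∀ x, |F x| ≤ M) {s : Set E}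
    (hs : μ s ≠ ⊤) : IntegrableOn F s μ := by
  have : IsFiniteMeasure (μ.restrict s) := ⟨by simpa using hs.lt_top⟩
  exact Integrable.of_bound hF.aestronglyMeasurable M (Filter.Eventually.of_forall hM)

lemma shift_aux {F : E → ℝ} (hF : Measurable F) {M : ℝ} (hM : ∀ x, |F x| ≤ M)
    {r : ℝ} (hr : 0 < r) {c w : E} {t : ℝ} (ht : t < r)
    (hcw : Metric.ball c (r - t) ⊆ Metric.ball w r) :
    |∫ z in Metric.ball w r, F z ∂μ - ∫ z in Metric.ball c (r - t), F z ∂μ| ≤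
      M * (Module.finrank ℝ E * (t / r) * μ.real (Metric.ball (0:E) r)) := by
  have := FiniteDimensional.proper ℝ E
  set d := Module.finrank ℝ E
  have hM0 : 0 ≤ M := (abs_nonneg _).trans (hM 0)
  have h1 := setIntegral_sdiff (μ := μ) (f := F) (s := Metric.ball w r)
    (t := Metric.ball c (r - t)) Metric.isOpen_ball.measurableSet
    (bdd_intOn μ hF hM measure_ball_lt_top.ne) hcw
  rw [← h1]
  have h2 := norm_setIntegral_le_of_norm_le_const (μ := μ) (f := F) (C := M)
    (s := Metric.ball w r \ Metric.ball c (r - t))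
    ((measure_mono sdiff_subset).trans_lt measure_ball_lt_top) (fun x _ => hM x)
  rw [Real.norm_eq_abs] at h2
  refine h2.trans (mul_le_mul_of_nonneg_left ?_ hM0)
  have h3 : μ.real (Metric.ball w r \ Metric.ball c (r - t)) =
      μ.real (Metric.ball w r) - μ.real (Metric.ball c (r - t)) :=
    measureReal_sdiff hcw Metric.isOpen_ball.measurableSet measure_ball_lt_top.ne
  rw [h3, real_ball μ w hr, real_ball μ c (by linarith : 0 < r - t), real_ball μ 0 hr]
  have hb := one_add_mul_le_pow (a := -(t/r)) (by
    have : t / r < 1 := by rw [div_lt_one hr]; exact ht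
    linarith) d
  have h4 : (r - t) ^ d = r ^ d * (1 + -(t/r)) ^ d := by
    rw [← mul_pow]; congr 1; field_simp; ring
  rw [h4]
  have h5 : 0 ≤ r ^ d * μ.real (Metric.ball (0:E) 1) := by positivity
  nlinarith [mul_le_mul_of_nonneg_left hb h5]

lemma shift_lem {F : E → ℝ} (hF : Measurable F) {M : ℝ} (hM : ∀ x, |F x| ≤ M)
    {r : ℝ} (hr : 0 < r) (w : E) (hd : 1 ≤ Module.finrank ℝ E) :
    |∫ z in Metric.ball (0:E) r, F (z + w) ∂μ - ∫ z in Metric.ball (0:E) r, F z ∂μ| ≤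
      2 * M * Module.finrank ℝ E * (‖w‖ / r) * μ.real (Metric.ball (0:E) r) := by
  have := FiniteDimensional.proper ℝ E
  have hM0 : 0 ≤ M := (abs_nonneg _).trans (hM 0)
  set d := Module.finrank ℝ E
  rcases lt_or_ge ‖w‖ r with h | h
  · have h1 : ∫ z in Metric.ball (0:E) r, F (z + w) ∂μ = ∫ z in Metric.ball w r, F z ∂μ := by
      rw [← integral_indicator Metric.isOpen_ball.measurableSet,
        ← integral_indicator Metric.isOpen_ball.measurableSet,
        ← integral_add_right_eq_self ((Metric.ball w r).indicator F) w]
      congr 1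
      ext z
      simp only [Set.indicator, Metric.mem_ball, dist_eq_norm, add_sub_cancel_right, sub_zero]
    rw [h1]
    have ha := shift_aux μ hF hM hr (c := 0) (w := w) h (by
      intro x hx
      rw [Metric.mem_ball] at *
      calc dist x w ≤ dist x 0 + dist 0 w := dist_triangle _ _ _
        _ < r := by rw [dist_zero_left]; linarith)
    have hb := shift_aux μ hF hM hr (c := 0) (w := 0) h (by
      apply Metric.ball_subset_ball; linarith [norm_nonneg w])
    rw [abs_le] at *
    constructor <;> nlinarith
  · have hb : ∀ G : E → ℝ, (∀ x, |G x| ≤ M) →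
        |∫ z in Metric.ball (0:E) r, G z ∂μ| ≤ M * μ.real (Metric.ball (0:E) r) := fun G hG => by
      rw [← Real.norm_eq_abs]
      exact norm_setIntegral_le_of_norm_le_const measure_ball_lt_top (fun x _ => hG x)
    have h1 := abs_le.1 (hb F hM)
    have h2 := abs_le.1 (hb (fun z => F (z + w)) (fun z => hM _))
    have h3 : 1 ≤ ‖w‖ / r := by rwa [le_div_iff₀ hr, one_mul]
    have hd' : (1:ℝ) ≤ d := by exact_mod_cast hd
    have h4 : 1 ≤ (d:ℝ) * (‖w‖ / r) := by nlinarith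
    have h5 : 0 ≤ 2 * M * μ.real (Metric.ball (0:E) r) := by positivity
    have h6 := mul_le_mul_of_nonneg_left h4 h5
    rw [abs_le]
    constructor <;> nlinarith

lemma avg_g {g : E → ℝ} (hg : Measurable g) {M : ℝ} (hM : ∀ x, |g x| ≤ M) (hg0 : ∀ x, 0 ≤ g x)
    {r R l : ℝ} (hl : 0 < l) (c : E)
    (hc : ∀ z ∈ Metric.ball (0:E) r, c + l • z ∈ Metric.ball (0:E) R) :
    ∫ z in Metric.ball (0:E) r, g (c + l • z) ∂μ ≤
      (l ^ Module.finrank ℝ E)⁻¹ * ∫ x in Metric.ball (0:E) R, g x ∂μ := by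
  have := FiniteDimensional.proper ℝ E
  set G := (Metric.ball (0:E) R).indicator g with hG
  have hGi : Integrable G μ := by
    rw [hG, integrable_indicator_iff Metric.isOpen_ball.measurableSet]
    exact bdd_intOn μ hg hM measure_ball_lt_top.ne
  have hG0 : ∀ x, 0 ≤ G x := fun x => Set.indicator_nonneg (fun x _ => hg0 x) x
  have h1 : ∫ z, G (c + l • z) ∂μ = (l ^ Module.finrank ℝ E)⁻¹ * ∫ x, G x ∂μ := by
    rw [Measure.integral_comp_smul μ (fun x => G (c + x)) l, integral_add_left_eq_self,
      abs_of_nonneg (by positivity), smul_eq_mul]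
  have hGi2 : Integrable (fun z => G (c + l • z)) μ :=
    Integrable.comp_smul (hGi.comp_add_left c) hl.ne'
  calc ∫ z in Metric.ball (0:E) r, g (c + l • z) ∂μ
      = ∫ z in Metric.ball (0:E) r, G (c + l • z) ∂μ := by
        refine setIntegral_congr_fun Metric.isOpen_ball.measurableSet fun z hz => ?_
        simp only [hG]
        rw [Set.indicator_of_mem (hc z hz)]
    _ ≤ ∫ z, G (c + l • z) ∂μ :=
        setIntegral_le_integral hGi2 (Filter.Eventually.of_forall fun z => hG0 _)
    _ = _ := by rw [h1, hG, integral_indicator Metric.isOpen_ball.measurableSet]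

/-- The average of `f` over small balls. -/
noncomputable def mol (f : E → ℝ) (r l : ℝ) (y : E) : ℝ :=
  (μ.real (Metric.ball (0:E) r))⁻¹ * ∫ z in Metric.ball (0:E) r, f ((1 - l) • y + l • z) ∂μ

lemma mol_bound {f : E → ℝ} {M : ℝ} (hM : ∀ x, |f x| ≤ M)
    {r l : ℝ} (hr : 0 < r) (y : E) : |mol μ f r l y| ≤ M := by
  have := FiniteDimensional.proper ℝ E
  have hp := real_ball_pos μ (0:E) hr
  rw [mol, abs_mul, abs_of_nonneg (by positivity), inv_mul_le_iff₀ hp, mul_comm, ← Real.norm_eq_abs]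
  exact norm_setIntegral_le_of_norm_le_const measure_ball_lt_top (fun x _ => hM _)

lemma mol_lip {f : E → ℝ} (hf : Measurable f) {M : ℝ} (hM : ∀ x, |f x| ≤ M)
    {r l : ℝ} (hr : 0 < r) (hl : 0 < l) (hl1 : l ≤ 1) (hd : 1 ≤ Module.finrank ℝ E) (y v : E) :
    |mol μ f r l (y + v) - mol μ f r l y| ≤ 2 * M * Module.finrank ℝ E * (‖v‖ / (l * r)) := by
  have hM0 : 0 ≤ M := (abs_nonneg _).trans (hM 0)
  have hp := real_ball_pos μ (0:E) hr
  have h := shift_lem μ (F := fun z => f ((1 - l) • y + l • z)) (by fun_prop) (fun z => hM _) hr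
    (l⁻¹ • (1 - l) • v) hd
  have h1 : ∀ z : E, (1 - l) • y + l • (z + l⁻¹ • (1 - l) • v) = (1 - l) • (y + v) + l • z := by
    intro z
    rw [smul_add, smul_smul l, mul_inv_cancel₀ hl.ne', one_smul, smul_add]; abel
  simp only [h1] at h
  rw [mol, mol, ← mul_sub, abs_mul, abs_of_nonneg (by positivity), inv_mul_le_iff₀ hp]
  refine h.trans ?_
  rw [mul_comm (μ.real _)]
  refine mul_le_mul_of_nonneg_right ?_ hp.le
  refine mul_le_mul_of_nonneg_left ?_ (by positivity)
  rw [norm_smul, norm_smul, Real.norm_eq_abs, Real.norm_eq_abs, abs_of_nonneg (by positivity),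
    abs_of_nonneg (by linarith), ← div_div]
  gcongr
  rw [div_eq_inv_mul]
  gcongr
  nlinarith [norm_nonneg v]

lemma mol_four {f g : E → ℝ} (hf : Measurable f) {M : ℝ} (hM : ∀ x, |f x| ≤ M)
    (hg : Measurable g) {M' : ℝ} (hM' : ∀ x, |g x| ≤ M') (hg0 : ∀ x, 0 ≤ g x)
    {r R l σ η t : ℝ} (hr : 0 < r) (hl : 0 < l) (hl1 : l ≤ 1) (ht0 : 0 ≤ t) (ht1 : t ≤ 1)
    {Ω : Set E} (hΩ : Convex ℝ Ω) (hrΩ : Metric.ball (0:E) r ⊆ Ω) (hΩR : Ω ⊆ Metric.ball (0:E) R)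
    (hη : ∫ x in Metric.ball (0:E) R, g x ∂μ ≤ η)
    (h4 : ∀ y₁ ∈ Ω, ∀ y₂ ∈ Ω, f y₁ + f y₂ ≤ f (t • y₁ + (1 - t) • y₂) + f ((1 - t) • y₁ + t • y₂)
      + σ + (g y₁ + g y₂ + g (t • y₁ + (1 - t) • y₂) + g ((1 - t) • y₁ + t • y₂)))
    {y₁ y₂ : E} (hy₁ : y₁ ∈ Ω) (hy₂ : y₂ ∈ Ω) :
    mol μ f r l y₁ + mol μ f r l y₂ ≤ mol μ f r l (t • y₁ + (1 - t) • y₂) +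
      mol μ f r l ((1 - t) • y₁ + t • y₂) +
      (σ + 4 * ((l ^ Module.finrank ℝ E)⁻¹ * η * (μ.real (Metric.ball (0:E) r))⁻¹)) := by
  have := FiniteDimensional.proper ℝ E
  have hp := real_ball_pos μ (0:E) hr
  set B := Metric.ball (0:E) r with hB
  have hmem : ∀ y ∈ Ω, ∀ z ∈ B, (1 - l) • y + l • z ∈ Ω := fun y hy z hz =>
    hΩ hy (hrΩ hz) (by linarith) hl.le (by ring)
  have hgm : ∀ y ∈ Ω, mol μ g r l y ≤
      (l ^ Module.finrank ℝ E)⁻¹ * η * (μ.real B)⁻¹ := by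
    intro y hy
    rw [mol, mul_comm]
    refine mul_le_mul_of_nonneg_right ?_ (by positivity)
    refine (avg_g μ hg hM' hg0 hl _ fun z hz => hΩR (hmem y hy z hz)).trans ?_
    gcongr
  have hp1 : t • y₁ + (1 - t) • y₂ ∈ Ω := hΩ hy₁ hy₂ ht0 (by linarith) (by ring)
  have hp2 : (1 - t) • y₁ + t • y₂ ∈ Ω := hΩ hy₁ hy₂ (by linarith) ht0 (by ring)
  have hif : ∀ y, IntegrableOn (fun z => f ((1 - l) • y + l • z)) B μ := fun y =>
    bdd_intOn μ (by fun_prop) (fun z => hM _) measure_ball_lt_top.ne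
  have hig : ∀ y, IntegrableOn (fun z => g ((1 - l) • y + l • z)) B μ := fun y =>
    bdd_intOn μ (by fun_prop) (fun z => hM' _) measure_ball_lt_top.ne
  have hic : IntegrableOn (fun _ : E => σ) B μ :=
    integrableOn_const measure_ball_lt_top.ne
  have key : mol μ f r l y₁ + mol μ f r l y₂ ≤ mol μ f r l (t • y₁ + (1 - t) • y₂) +
      mol μ f r l ((1 - t) • y₁ + t • y₂) + σ + (mol μ g r l y₁ + mol μ g r l y₂ +
        mol μ g r l (t • y₁ + (1 - t) • y₂) + mol μ g r l ((1 - t) • y₁ + t • y₂)) := by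
    have hσ : (μ.real B)⁻¹ * ∫ z in B, σ ∂μ = σ := by
      rw [setIntegral_const, smul_eq_mul, inv_mul_cancel_left₀ hp.ne']
    suffices hI : (∫ z in B, f ((1 - l) • y₁ + l • z) ∂μ) + ∫ z in B, f ((1 - l) • y₂ + l • z) ∂μ ≤
        (∫ z in B, f ((1 - l) • (t • y₁ + (1 - t) • y₂) + l • z) ∂μ) +
        (∫ z in B, f ((1 - l) • ((1 - t) • y₁ + t • y₂) + l • z) ∂μ) + (∫ z in B, σ ∂μ) +
        ((∫ z in B, g ((1 - l) • y₁ + l • z) ∂μ) + (∫ z in B, g ((1 - l) • y₂ + l • z) ∂μ) +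
        (∫ z in B, g ((1 - l) • (t • y₁ + (1 - t) • y₂) + l • z) ∂μ) +
        (∫ z in B, g ((1 - l) • ((1 - t) • y₁ + t • y₂) + l • z) ∂μ)) by
      have hI2 := mul_le_mul_of_nonneg_left hI (inv_nonneg.2 hp.le)
      simp only [mul_add, hσ] at hI2
      simp only [mol]
      linarith
    have hmono := setIntegral_mono_on ((hif y₁).add (hif y₂))
        ((((hif (t • y₁ + (1 - t) • y₂)).add (hif ((1 - t) • y₁ + t • y₂))).add hic).add
        ((((hig y₁).add (hig y₂)).add (hig (t • y₁ + (1 - t) • y₂))).add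
          (hig ((1 - t) • y₁ + t • y₂)))) Metric.isOpen_ball.measurableSet (by
      intro z hz
      have h := h4 _ (hmem y₁ hy₁ z hz) _ (hmem y₂ hy₂ z hz)
      have e1 : t • ((1 - l) • y₁ + l • z) + (1 - t) • ((1 - l) • y₂ + l • z) =
        (1 - l) • (t • y₁ + (1 - t) • y₂) + l • z := by module
      have e2 : (1 - t) • ((1 - l) • y₁ + l • z) + t • ((1 - l) • y₂ + l • z) =
        (1 - l) • ((1 - t) • y₁ + t • y₂) + l • z := by module
      rw [e1, e2] at h
      simpa using h)
    rw [integral_add' (hif _) (hif _),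
      integral_add' (((hif _).add (hif _)).add hic)
        ((((hig _).add (hig _)).add (hig _)).add (hig _)),
      integral_add' ((hif _).add (hif _)) hic, integral_add' (hif _) (hif _),
      integral_add' (((hig _).add (hig _)).add (hig _)) (hig _),
      integral_add' ((hig _).add (hig _)) (hig _), integral_add' (hig _) (hig _)] at hmono
    exact hmono
  have a1 := hgm _ hy₁
  have a2 := hgm _ hy₂
  have a3 := hgm _ hp1
  have a4 := hgm _ hp2
  linarith

lemma mol_L1 {f : E → ℝ} (hf : Measurable f) {M : ℝ} (hM : ∀ x, |f x| ≤ M)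
    {r R l : ℝ} (hr : 0 < r) (hrR : r ≤ R) {κ : ℝ≥0∞}
    (hreg : ∀ z ∈ Metric.ball (0:E) R, ∫⁻ y in Metric.ball (0:E) R,
      ENNReal.ofReal |f ((1 - l) • y + l • z) - f y| ∂μ ≤ κ) :
    ∫⁻ y in Metric.ball (0:E) R, ENNReal.ofReal |mol μ f r l y - f y| ∂μ ≤ κ := by
  have := FiniteDimensional.proper ℝ E
  have hp := real_ball_pos μ (0:E) hr
  set B := Metric.ball (0:E) r with hB
  have hB0 : μ B ≠ 0 := (Metric.measure_ball_pos μ (0:E) hr).ne'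
  have hBt : μ B ≠ ⊤ := measure_ball_lt_top.ne
  have h1 : ∀ y, ENNReal.ofReal |mol μ f r l y - f y| ≤
      (μ B)⁻¹ * ∫⁻ z in B, ENNReal.ofReal |f ((1 - l) • y + l • z) - f y| ∂μ := by
    intro y
    have e : mol μ f r l y - f y =
        (μ.real B)⁻¹ * ∫ z in B, (f ((1 - l) • y + l • z) - f y) ∂μ := by
      rw [integral_sub (bdd_intOn μ (by fun_prop) (fun z => hM _) hBt)
        (integrableOn_const hBt), mul_sub, setIntegral_const, smul_eq_mul,
        inv_mul_cancel_left₀ hp.ne', mol]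
    rw [e, abs_mul, ENNReal.ofReal_mul (abs_nonneg _), abs_of_nonneg (by positivity),
      ENNReal.ofReal_inv_of_pos hp, Measure.real, ENNReal.ofReal_toReal hBt]
    gcongr
    simp only [← Real.norm_eq_abs, ofReal_norm]
    exact enorm_integral_le_lintegral_enorm _
  calc ∫⁻ y in Metric.ball (0:E) R, ENNReal.ofReal |mol μ f r l y - f y| ∂μ
      ≤ ∫⁻ y in Metric.ball (0:E) R,
        (μ B)⁻¹ * ∫⁻ z in B, ENNReal.ofReal |f ((1 - l) • y + l • z) - f y| ∂μ ∂μ :=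
        lintegral_mono fun y => h1 y
    _ = (μ B)⁻¹ * ∫⁻ y in Metric.ball (0:E) R,
        ∫⁻ z in B, ENNReal.ofReal |f ((1 - l) • y + l • z) - f y| ∂μ ∂μ :=
        lintegral_const_mul' _ _ (ENNReal.inv_ne_top.2 hB0)
    _ = (μ B)⁻¹ * ∫⁻ z in B, ∫⁻ y in Metric.ball (0:E) R,
        ENNReal.ofReal |f ((1 - l) • y + l • z) - f y| ∂μ ∂μ := by
        rw [lintegral_lintegral_swap]
        apply Measurable.aemeasurable
        simp only [Function.uncurry_def]
        have : Measurable fun p : E × E => (1 - l) • p.1 + l • p.2 := by fun_prop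
        have h2 : Measurable fun p : E × E => f ((1 - l) • p.1 + l • p.2) := hf.comp this
        have h3 : Measurable fun p : E × E => f p.1 := hf.comp measurable_fst
        exact ENNReal.measurable_ofReal.comp (h2.sub h3).norm
    _ ≤ (μ B)⁻¹ * ∫⁻ z in B, κ ∂μ := by
        gcongr 1
        refine setLIntegral_mono measurable_const fun z hz => ?_
        exact hreg z (Metric.ball_subset_ball hrR hz)
    _ = κ := by
        rw [setLIntegral_const, mul_comm κ, ← mul_assoc, ENNReal.inv_mul_cancel hB0 hBt, one_mul]

end MOL

section CORE
variable {E : Type*} [NormedAddCommGroup E] [NormedSpace ℝ E]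

lemma iter_lem {Ω : Set E} (hΩ : Convex ℝ Ω) {u : E → ℝ} {t σ : ℝ} (ht0 : 1/2 ≤ t) (ht1 : t ≤ 1)
    (h4 : ∀ y₁ ∈ Ω, ∀ y₂ ∈ Ω, u y₁ + u y₂ ≤ u (t • y₁ + (1 - t) • y₂) +
      u ((1 - t) • y₁ + t • y₂) + σ) {x y : E} (hx : x ∈ Ω) (hy : y ∈ Ω) (k : ℕ) :
    u x + u y ≤ u (((1/2:ℝ) • x + (1/2:ℝ) • y) + ((2*t-1)^k/2) • (x - y)) +
      u (((1/2:ℝ) • x + (1/2:ℝ) • y) + ((2*t-1)^k/2) • (y - x)) + k * σ := by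
  induction k with
  | zero =>
    have e1 : ((1/2:ℝ) • x + (1/2:ℝ) • y) + ((2*t-1)^0/2) • (x - y) = x := by
      rw [pow_zero]; module
    have e2 : ((1/2:ℝ) • x + (1/2:ℝ) • y) + ((2*t-1)^0/2) • (y - x) = y := by
      rw [pow_zero]; module
    rw [e1, e2]; simp
  | succ k ih =>
    have hq0 : 0 ≤ (2*t-1)^k := pow_nonneg (by linarith) k
    have hq1 : (2*t-1)^k ≤ 1 := pow_le_one₀ (by linarith) (by linarith)
    have hp : ((1/2:ℝ) • x + (1/2:ℝ) • y) + ((2*t-1)^k/2) • (x - y) ∈ Ω := by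
      have : ((1/2:ℝ) • x + (1/2:ℝ) • y) + ((2*t-1)^k/2) • (x - y) =
        (1/2 + (2*t-1)^k/2) • x + (1/2 - (2*t-1)^k/2) • y := by module
      rw [this]
      exact hΩ hx hy (by linarith) (by linarith) (by ring)
    have hq : ((1/2:ℝ) • x + (1/2:ℝ) • y) + ((2*t-1)^k/2) • (y - x) ∈ Ω := by
      have : ((1/2:ℝ) • x + (1/2:ℝ) • y) + ((2*t-1)^k/2) • (y - x) =
        (1/2 - (2*t-1)^k/2) • x + (1/2 + (2*t-1)^k/2) • y := by module
      rw [this]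
      exact hΩ hx hy (by linarith) (by linarith) (by ring)
    have h := h4 _ hp _ hq
    have e1 : t • (((1/2:ℝ) • x + (1/2:ℝ) • y) + ((2*t-1)^k/2) • (x - y)) +
        (1 - t) • (((1/2:ℝ) • x + (1/2:ℝ) • y) + ((2*t-1)^k/2) • (y - x)) =
        ((1/2:ℝ) • x + (1/2:ℝ) • y) + ((2*t-1)^(k+1)/2) • (x - y) := by
      rw [pow_succ]; module
    have e2 : (1 - t) • (((1/2:ℝ) • x + (1/2:ℝ) • y) + ((2*t-1)^k/2) • (x - y)) +
        t • (((1/2:ℝ) • x + (1/2:ℝ) • y) + ((2*t-1)^k/2) • (y - x)) =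
        ((1/2:ℝ) • x + (1/2:ℝ) • y) + ((2*t-1)^(k+1)/2) • (y - x) := by
      rw [pow_succ]; module
    rw [e1, e2] at h
    push_cast
    linarith

lemma core_lem [FiniteDimensional ℝ E] {Ω : Set E} (hΩ : Convex ℝ Ω) {R : ℝ}
    (hR : Ω ⊆ Metric.ball (0:E) R)
    {u : E → ℝ} {t σ M Λ : ℝ} (ht0 : 1/2 ≤ t) (ht1 : t ≤ 1) (hσ : 0 ≤ σ) (hR0 : 0 ≤ R) (hΛ : 0 ≤ Λ)
    (hb : ∀ x ∈ Ω, |u x| ≤ M)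
    (hlip : ∀ y v, |u (y + v) - u y| ≤ Λ * ‖v‖)
    (h4 : ∀ y₁ ∈ Ω, ∀ y₂ ∈ Ω, u y₁ + u y₂ ≤ u (t • y₁ + (1 - t) • y₂) +
      u ((1 - t) • y₁ + t • y₂) + σ) (k : ℕ) :
    ∃ Ψ : E → ℝ, ConcaveOn ℝ Ω Ψ ∧ (∀ y ∈ Ω, |Ψ y| ≤ M) ∧
      ∀ y ∈ Ω, |Ψ y - u y| ≤ (Module.finrank ℝ E + 2) * (k * σ + 2 * Λ * R * (2*t-1)^k) := by
  have hq0 : 0 ≤ (2*t-1)^k := pow_nonneg (by linarith) k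
  refine hyers_ulam hΩ hb ?_ (by positivity)
  intro x hx y hy
  have h := iter_lem hΩ ht0 ht1 h4 hx hy k
  have hxn : ‖x‖ < R := by simpa using hR hx
  have hyn : ‖y‖ < R := by simpa using hR hy
  have hn1 : ‖((2*t-1)^k/2) • (x - y)‖ ≤ (2*t-1)^k * R := by
    rw [norm_smul, Real.norm_eq_abs, abs_of_nonneg (by positivity)]
    have := norm_sub_le x y
    nlinarith
  have hn2 : ‖((2*t-1)^k/2) • (y - x)‖ ≤ (2*t-1)^k * R := by
    rw [norm_smul, Real.norm_eq_abs, abs_of_nonneg (by positivity)]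
    have := norm_sub_le y x
    nlinarith
  have h1 := (abs_le.1 (hlip ((1/2:ℝ) • x + (1/2:ℝ) • y) (((2*t-1)^k/2) • (x - y)))).2
  have h2 := (abs_le.1 (hlip ((1/2:ℝ) • x + (1/2:ℝ) • y) (((2*t-1)^k/2) • (y - x)))).2
  have h3 := mul_le_mul_of_nonneg_left hn1 hΛ
  have h4 := mul_le_mul_of_nonneg_left hn2 hΛ
  linarith
end CORE

lemma count_lem {N : ℕ} {x a ε : ℝ} (hε : 0 < ε) (hx0 : 0 ≤ x) (hxN : x ≤ N * ε) (ha0 : 0 ≤ a)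
    (ha : a ≤ ε) :
    |ε * ∑ i ∈ Finset.range N, (if a + i * ε < x then (1:ℝ) else 0) - x| ≤ ε := by
  set q := (x - a) / ε with hq
  have hxq : x = ε * q + a := by rw [hq]; field_simp; ring
  have hfil : (Finset.range N).filter (fun i : ℕ => a + i * ε < x) =
      Finset.range ⌈q⌉₊ := by
    ext i
    simp only [Finset.mem_filter, Finset.mem_range, Nat.lt_ceil]
    have h1 : a + i * ε < x ↔ (i:ℝ) < q := by
      rw [hq, lt_div_iff₀ hε]; constructor <;> intro h <;> linarith
    rw [h1]
    refine ⟨fun h => h.2, fun h => ⟨?_, h⟩⟩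
    have h2 : (i:ℝ) * ε < N * ε := by
      rw [← h1] at h; linarith
    exact_mod_cast lt_of_mul_lt_mul_right h2 hε.le
  rw [Finset.sum_ite, Finset.sum_const_zero, add_zero, Finset.sum_const, hfil, Finset.card_range,
    nsmul_eq_mul, mul_one]
  have h1 : q ≤ ⌈q⌉₊ := Nat.le_ceil q
  rcases le_or_gt q 0 with h | h
  · rw [Nat.ceil_eq_zero.2 h]
    rw [abs_le]
    have : ε * q ≤ 0 := mul_nonpos_of_nonneg_of_nonpos hε.le h
    constructor <;> push_cast <;> linarith
  · have h2 : (⌈q⌉₊:ℝ) < q + 1 := Nat.ceil_lt_add_one h.le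
    have h3 := mul_le_mul_of_nonneg_left h1 hε.le
    have h4 := mul_le_mul_of_nonneg_left h2.le hε.le
    rw [abs_le]
    constructor <;> linarith

lemma offset_lem {φ : ℝ → ℝ≥0∞} (hφ : Measurable φ) {ε b : ℝ} (hε : 0 < ε) (N : ℕ) :
    ∃ a, 0 ≤ a ∧ a ≤ ε ∧
      ENNReal.ofReal ε * ∑ i ∈ Finset.range N, φ (b + (a + i * ε)) ≤ ∫⁻ s, φ s := by
  have hvol : volume (Ioc 0 ε) = ENNReal.ofReal ε := by rw [Real.volume_Ioc, sub_zero]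
  have hm : Measurable fun a => ∑ i ∈ Finset.range N, φ (b + (a + i * ε)) := by
    refine Finset.measurable_fun_sum _ fun i _ => ?_
    exact hφ.comp (by fun_prop)
  have hne : ENNReal.ofReal ε ≠ 0 := by simpa using hε
  obtain ⟨a, ha, h⟩ := exists_le_setLAverage (μ := volume) (s := Ioc 0 ε)
    (f := fun a => ∑ i ∈ Finset.range N, φ (b + (a + i * ε)))
    (by rw [hvol]; exact hne) (by rw [hvol]; exact ENNReal.ofReal_ne_top) hm.aemeasurable
  refine ⟨a, ha.1.le, ha.2, ?_⟩
  rw [setLAverage_eq, hvol, ENNReal.le_div_iff_mul_le (Or.inl hne) (Or.inl ENNReal.ofReal_ne_top),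
    mul_comm] at h
  refine h.trans ?_
  rw [lintegral_finsetSum (f := fun (i : ℕ) a => φ (b + (a + i * ε))) _
    (fun i _ => hφ.comp (by fun_prop))]
  set c : ℕ → ℝ := fun i => b + i * ε with hc
  have hcm : Monotone c := by
    intro i j hij
    have : (i:ℝ) ≤ j := by exact_mod_cast hij
    simp only [hc]
    nlinarith
  have h1 : ∀ i : ℕ, ∫⁻ a in Ioc 0 ε, φ (b + (a + i * ε)) = ∫⁻ s in Ioc (c i) (c (i+1)), φ s := by
    intro i
    rw [← lintegral_indicator measurableSet_Ioc, ← lintegral_indicator measurableSet_Ioc,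
      ← lintegral_add_left_eq_self ((Ioc (c i) (c (i+1))).indicator φ) (c i)]
    congr 1
    ext a
    have e1 : (c i + a ∈ Ioc (c i) (c (i+1))) ↔ a ∈ Ioc 0 ε := by
      simp only [hc, mem_Ioc]
      push_cast
      constructor <;> rintro ⟨h1, h2⟩ <;> constructor <;> linarith
    have e2 : b + (a + i * ε) = c i + a := by simp only [hc]; ring
    by_cases hh : a ∈ Ioc 0 ε
    · rw [indicator_of_mem hh, indicator_of_mem (e1.2 hh), e2]
    · rw [indicator_of_notMem hh, indicator_of_notMem (fun h => hh (e1.1 h))]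
  simp only [h1]
  have hpd := hcm.pairwise_disjoint_on_Ioc_succ
  rw [← lintegral_biUnion_finset (s := Finset.range N)
    (t := fun i => Ioc (c i) (c (i+1))) (fun i _ j _ hij => hpd hij) (fun i _ => measurableSet_Ioc)]
  exact setLIntegral_le_lintegral _ _

section DISC
variable {E : Type*} [NormedAddCommGroup E] [NormedSpace ℝ E] [FiniteDimensional ℝ E]
  [MeasurableSpace E] [BorelSpace E] (μ : Measure E) [μ.IsAddHaarMeasure]

lemma convex_nullMeas {K : Set E} (hK : Convex ℝ K) : NullMeasurableSet K μ :=
  hK.nullMeasurableSet μ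

lemma phi_meas {R : ℝ} {Ω : Set E} (hΩ : Convex ℝ Ω) (hR : Ω ⊆ Metric.ball (0:E) R)
    (S : ℝ → Set E) (hS : ∀ s, S s ⊆ Ω) (hanti : Antitone S) :
    Measurable fun s => min (μ (convexHull ℝ (S s) \ S s)) (μ (S s)) := by
  have := FiniteDimensional.proper ℝ E
  have hfin : μ Ω < ⊤ := (measure_mono hR).trans_lt measure_ball_lt_top
  have hco : ∀ s, convexHull ℝ (S s) ⊆ Ω := fun s => convexHull_min (hS s) hΩ
  refine Measurable.min ?_ (Antitone.measurable fun s t h => measure_mono (hanti h))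
  have e : (fun s => μ (convexHull ℝ (S s) \ S s)) =
      fun s => μ (Ω \ S s) - μ (Ω \ convexHull ℝ (S s)) := by
    ext s
    have h := measure_inter_add_sdiff₀ (μ := μ) (Ω \ S s)
      (convex_nullMeas μ (convex_convexHull ℝ (S s)))
    have h1 : (Ω \ S s) ∩ convexHull ℝ (S s) = convexHull ℝ (S s) \ S s := by
      ext x
      simp only [mem_inter_iff, mem_sdiff]
      exact ⟨fun h => ⟨h.2, h.1.2⟩, fun h => ⟨⟨hco s h.1, h.2⟩, h.1⟩⟩
    have h2 : (Ω \ S s) \ convexHull ℝ (S s) = Ω \ convexHull ℝ (S s) := by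
      ext x
      simp only [mem_sdiff]
      exact ⟨fun h => ⟨h.1.1, h.2⟩, fun h => ⟨⟨h.1, fun h' => h.2 (subset_convexHull ℝ _ h')⟩, h.2⟩⟩
    rw [h1, h2] at h
    rw [← h, ENNReal.add_sub_cancel_right]
    exact ((measure_mono sdiff_subset).trans_lt hfin).ne
  rw [e]
  refine Measurable.sub (Monotone.measurable fun s t h => measure_mono ?_)
    (Monotone.measurable fun s t h => measure_mono ?_)
  · exact sdiff_subset_sdiff_right (hanti h)
  · exact sdiff_subset_sdiff_right (convexHull_mono (hanti h))

lemma approx_conv (A : Set E) : ∃ K : Set E, Convex ℝ K ∧ MeasurableSet K ∧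
    μ {y | ¬ (y ∈ K ↔ y ∈ A)} ≤ min (μ (convexHull ℝ A \ A)) (μ A) := by
  by_cases h : μ (convexHull ℝ A \ A) ≤ μ A
  · refine ⟨interior (convexHull ℝ A), (convex_convexHull ℝ A).interior,
      isOpen_interior.measurableSet, ?_⟩
    rw [min_eq_left h]
    have hsub : {y | ¬ (y ∈ interior (convexHull ℝ A) ↔ y ∈ A)} ⊆
        (convexHull ℝ A \ A) ∪ frontier (convexHull ℝ A) := by
      intro y hy
      by_cases hA : y ∈ A
      · right
        rw [frontier]
        refine ⟨subset_closure (subset_convexHull ℝ A hA), fun h' => hy ⟨fun _ => hA, fun _ => h'⟩⟩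
      · left
        refine ⟨?_, hA⟩
        by_contra h'
        exact hy ⟨fun h2 => absurd (interior_subset h2) h', fun h2 => absurd h2 hA⟩
    refine (measure_mono hsub).trans ((measure_union_le _ _).trans ?_)
    rw [(convex_convexHull ℝ A).addHaar_frontier μ, add_zero]
  · refine ⟨∅, convex_empty, MeasurableSet.empty, ?_⟩
    rw [min_eq_right (not_le.1 h).le]
    refine measure_mono fun y hy => ?_
    simpa using hy

lemma ind_abs {A B G : Set E} {x y w : E} (h : ¬ (x ∈ A ↔ y ∈ B) → w ∈ G) :
    |A.indicator (1 : E → ℝ) x - B.indicator (1 : E → ℝ) y| ≤ G.indicator (1 : E → ℝ) w := by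
  by_cases hG : w ∈ G
  · rw [indicator_of_mem hG]
    by_cases h1 : x ∈ A <;> by_cases h2 : y ∈ B <;> simp [h1, h2]
  · have : (x ∈ A ↔ y ∈ B) := by by_contra h'; exact hG (h h')
    rw [indicator_of_notMem hG]
    by_cases h1 : x ∈ A
    · simp [h1, this.1 h1]
    · have h2 : y ∉ B := fun h2 => h1 (this.2 h2)
      simp [h1, h2]

lemma disc_lem {R : ℝ} {F : Set E} (hR : convexHull ℝ F ⊆ Metric.ball (0:E) R)
    {ψ : E → ℝ} {M ς : ℝ} (hM : 0 < M) (hψ : ∀ y ∈ F, -M ≤ ψ y ∧ ψ y ≤ M)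
    (hnull : μ (convexHull ℝ F \ F) = 0)
    (hφ : ∫⁻ s, min (μ (convexHull ℝ {y ∈ F | s < ψ y} \ {y ∈ F | s < ψ y}))
      (μ {y ∈ F | s < ψ y}) ≤ ENNReal.ofReal ς) (hς : 0 ≤ ς) (N : ℕ) (hN : 0 < N) :
    ∃ f g : E → ℝ, Measurable f ∧ Measurable g ∧ (∀ x, |f x| ≤ M) ∧ (∃ M', ∀ x, |g x| ≤ M') ∧
      (∀ x, 0 ≤ g x) ∧ (∀ y ∈ F, |f y - ψ y| ≤ g y) ∧
      (∀ y ∈ convexHull ℝ F, y ∉ F → 4 * M ≤ g y) ∧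
      ∫⁻ y in Metric.ball (0:E) R, ENNReal.ofReal (g y) ∂μ ≤
        ENNReal.ofReal (2 * M / N * μ.real (Metric.ball (0:E) R) + ς) ∧
      ∀ l : ℝ, 0 < l → l ≤ 1/2 → ∀ z ∈ Metric.ball (0:E) R, ∫⁻ y in Metric.ball (0:E) R,
        ENNReal.ofReal |f ((1 - l) • y + l • z) - f y| ∂μ ≤
        ENNReal.ofReal (2 * M * (8 * 2 ^ Module.finrank ℝ E * l * μ.real (Metric.ball (0:E) R))) := by
  have := FiniteDimensional.proper ℝ E
  set ε := 2 * M / N with hε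
  have hN' : (0:ℝ) < N := by exact_mod_cast hN
  have hε0 : 0 < ε := by positivity
  have hNε : N * ε = 2 * M := by rw [hε]; field_simp
  set S : ℝ → Set E := fun s => {y ∈ F | s < ψ y} with hS
  set φ : ℝ → ℝ≥0∞ := fun s => min (μ (convexHull ℝ (S s) \ S s)) (μ (S s)) with hφd
  have hφm : Measurable φ := phi_meas μ (convex_convexHull ℝ F) hR S
    (fun s y hy => subset_convexHull ℝ F hy.1) (fun s t h y hy => ⟨hy.1, lt_of_le_of_lt h hy.2⟩)
  obtain ⟨a, ha0, ha, hsum⟩ := offset_lem hφm (b := -M) hε0 N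
  set s : ℕ → ℝ := fun i => -M + (a + i * ε) with hs
  choose K hKc hKm hKμ using fun i => approx_conv μ (S (s i))
  set G : ℕ → Set E := fun i => toMeasurable μ {y | ¬ (y ∈ K i ↔ y ∈ S (s i))} with hG
  set G' : Set E := toMeasurable μ (convexHull ℝ F \ F) with hG'
  have hGm : ∀ i, MeasurableSet (G i) := fun i => measurableSet_toMeasurable _ _
  have hGm' : MeasurableSet G' := measurableSet_toMeasurable _ _
  have hGμ : ∀ i, μ (G i) ≤ φ (s i) := fun i => by
    rw [hG, measure_toMeasurable]; exact hKμ i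
  have hGμ' : μ G' = 0 := by rw [hG', measure_toMeasurable]; exact hnull
  have hind0 : ∀ (A : Set E) x, 0 ≤ A.indicator (1 : E → ℝ) x := fun A x =>
    indicator_nonneg (fun _ _ => zero_le_one) x
  have hind1 : ∀ (A : Set E) x, A.indicator (1 : E → ℝ) x ≤ 1 := fun A x =>
    indicator_le_self' (fun _ _ => zero_le_one) x
  have hindm : ∀ A : Set E, MeasurableSet A → Measurable (A.indicator (1 : E → ℝ)) := fun A hA =>
    measurable_one.indicator hA
  have hsumle : ∀ (A : ℕ → Set E) x,
      ∑ i ∈ Finset.range N, (A i).indicator (1 : E → ℝ) x ≤ N := by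
    intro A x
    calc _ ≤ ∑ i ∈ Finset.range N, (1:ℝ) := Finset.sum_le_sum fun i _ => hind1 _ _
      _ = N := by simp
  have hsum0 : ∀ (A : ℕ → Set E) x,
      0 ≤ ∑ i ∈ Finset.range N, (A i).indicator (1 : E → ℝ) x := fun A x =>
    Finset.sum_nonneg fun i _ => hind0 _ _
  have hsumm : ∀ (A : ℕ → Set E), (∀ i, MeasurableSet (A i)) →
      Measurable fun x => ∑ i ∈ Finset.range N, (A i).indicator (1 : E → ℝ) x := fun A hA =>
    Finset.measurable_fun_sum _ fun i _ => hindm _ (hA i)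
  have hlint : ∀ (A : ℕ → Set E), (∀ i, MeasurableSet (A i)) →
      ∫⁻ y in Metric.ball (0:E) R,
        ENNReal.ofReal (ε * ∑ i ∈ Finset.range N, (A i).indicator (1 : E → ℝ) y) ∂μ =
      ENNReal.ofReal ε * ∑ i ∈ Finset.range N, μ (A i ∩ Metric.ball (0:E) R) := by
    intro A hA
    have e : ∀ y, ENNReal.ofReal (ε * ∑ i ∈ Finset.range N, (A i).indicator (1 : E → ℝ) y) =
        ENNReal.ofReal ε * ∑ i ∈ Finset.range N, (A i).indicator (1 : E → ℝ≥0∞) y := by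
      intro y
      rw [ENNReal.ofReal_mul hε0.le, ENNReal.ofReal_sum_of_nonneg (fun i _ => hind0 _ _)]
      congr 1
      refine Finset.sum_congr rfl fun i _ => ?_
      by_cases h : y ∈ A i <;> simp [h]
    simp only [e]
    rw [lintegral_const_mul' _ _ ENNReal.ofReal_ne_top, lintegral_finsetSum _ (fun i _ =>
      measurable_one.indicator (hA i))]
    congr 1
    refine Finset.sum_congr rfl fun i _ => ?_
    rw [lintegral_indicator_one (hA i), Measure.restrict_apply (hA i)]
  set f : E → ℝ := fun y => -M + ε * ∑ i ∈ Finset.range N, (K i).indicator (1 : E → ℝ) y with hf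
  set g : E → ℝ := fun y => ε + ε * ∑ i ∈ Finset.range N, (G i).indicator (1 : E → ℝ) y
    + 4 * M * G'.indicator (1 : E → ℝ) y with hg
  have hg0 : ∀ x, 0 ≤ g x := by
    intro x
    have h1 := hsum0 G x
    have h2 := hind0 G' x
    simp only [hg]; positivity
  refine ⟨f, g, ?_, ?_, ?_, ⟨ε + ε * N + 4 * M, ?_⟩, hg0, ?_, ?_, ?_, ?_⟩
  · exact ((hsumm K hKm).const_mul ε).const_add (-M)
  · exact (((hsumm G hGm).const_mul ε).const_add ε).add ((hindm _ hGm').const_mul (4*M))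
  · intro x
    have h1 := hsum0 K x
    have h2 := mul_le_mul_of_nonneg_left (hsumle K x) hε0.le
    have h3 := mul_nonneg hε0.le h1
    simp only [hf]
    rw [abs_le]
    constructor <;> linarith
  · intro x
    rw [abs_of_nonneg (hg0 x)]
    have h2 := mul_le_mul_of_nonneg_left (hsumle G x) hε0.le
    have h3 := mul_le_mul_of_nonneg_left (hind1 G' x) (by positivity : 0 ≤ 4 * M)
    simp only [hg]
    linarith
  · intro y hy
    have hb := hψ y hy
    have hc := count_lem (N := N) (x := ψ y + M) hε0 (by linarith) (by linarith) ha0 ha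
    have e : ∀ i : ℕ, (if a + i * ε < ψ y + M then (1:ℝ) else 0) =
        (S (s i)).indicator (1 : E → ℝ) y := by
      intro i
      have : y ∈ S (s i) ↔ a + i * ε < ψ y + M := by
        simp only [hS, hs, mem_setOf_eq, hy, true_and]
        constructor <;> intro h <;> linarith
      by_cases h : y ∈ S (s i)
      · rw [indicator_of_mem h, if_pos (this.1 h)]; rfl
      · rw [indicator_of_notMem h, if_neg (fun h' => h (this.2 h'))]
    simp only [e] at hc
    have hd : |∑ i ∈ Finset.range N, (K i).indicator (1 : E → ℝ) y -
        ∑ i ∈ Finset.range N, (S (s i)).indicator (1 : E → ℝ) y| ≤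
        ∑ i ∈ Finset.range N, (G i).indicator (1 : E → ℝ) y := by
      rw [← Finset.sum_sub_distrib]
      refine (Finset.abs_sum_le_sum_abs _ _).trans (Finset.sum_le_sum fun i _ => ?_)
      exact ind_abs fun h => subset_toMeasurable μ _ h
    have hd1 := abs_le.1 hd
    have hc1 := abs_le.1 hc
    have h1 := mul_le_mul_of_nonneg_left hd1.1 hε0.le
    have h2 := mul_le_mul_of_nonneg_left hd1.2 hε0.le
    have h3 : 0 ≤ 4 * M * G'.indicator (1 : E → ℝ) y := mul_nonneg (by positivity) (hind0 G' y)
    simp only [hf, hg]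
    rw [abs_le]
    constructor <;> linarith
  · intro y hy hyF
    have hmem : y ∈ G' := subset_toMeasurable μ _ ⟨hy, hyF⟩
    have h1 := mul_nonneg hε0.le (hsum0 G y)
    simp only [hg]
    rw [indicator_of_mem hmem]
    simp only [Pi.one_apply]
    linarith
  · have e : ∀ y, ENNReal.ofReal (g y) = ENNReal.ofReal ε +
        ENNReal.ofReal (ε * ∑ i ∈ Finset.range N, (G i).indicator (1 : E → ℝ) y) +
        ENNReal.ofReal (4 * M * G'.indicator (1 : E → ℝ) y) := by
      intro y
      have h1 := mul_nonneg hε0.le (hsum0 G y)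
      have h3 : 0 ≤ 4 * M * G'.indicator (1 : E → ℝ) y := mul_nonneg (by positivity) (hind0 G' y)
      rw [← ENNReal.ofReal_add hε0.le h1, ← ENNReal.ofReal_add (by positivity) h3]
    simp only [e]
    have hz : ∫⁻ y in Metric.ball (0:E) R, ENNReal.ofReal (4 * M * G'.indicator (1 : E → ℝ) y) ∂μ
        = 0 := by
      have hae : ∀ᵐ y ∂μ, y ∉ G' := measure_eq_zero_iff_ae_notMem.1 hGμ'
      rw [lintegral_congr_ae (g := fun _ => 0), lintegral_zero]
      filter_upwards [ae_restrict_of_ae hae] with y hy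
      rw [indicator_of_notMem hy]; simp
    rw [lintegral_add_right _ (((hindm _ hGm').const_mul (4*M)).ennreal_ofReal), hz,
      add_zero, lintegral_add_left measurable_const, setLIntegral_const, hlint G hGm,
      ENNReal.ofReal_add (by positivity) hς, ENNReal.ofReal_mul hε0.le, Measure.real,
      ENNReal.ofReal_toReal measure_ball_lt_top.ne]
    gcongr
    refine le_trans ?_ (hsum.trans hφ)
    gcongr with i
    exact (measure_mono inter_subset_left).trans (hGμ i)
  · intro l hl0 hl1 z hz
    have eT : ∀ y, (1 - l) • y + l • z = AffineMap.homothety z (1 - l) y := by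
      intro y
      rw [AffineMap.homothety_apply, vsub_eq_sub, vadd_eq_add]; module
    set D : ℕ → Set E := fun i => {y | ¬ (y ∈ K i ↔ AffineMap.homothety z (1 - l) y ∈ K i)} with hD
    have hcm : Measurable (AffineMap.homothety z (1-l) : E → E) :=
      (AffineMap.homothety_continuous z _).measurable
    have hDm : ∀ i, MeasurableSet (D i) := fun i =>
      (MeasurableSet.iff (hKm i) (hcm (hKm i))).compl
    have hDμ : ∀ i, μ (D i ∩ Metric.ball (0:E) R) ≤
        ENNReal.ofReal (8 * 2 ^ Module.finrank ℝ E * l) * μ (Metric.ball (0:E) R) := by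
      intro i
      have := hom_diff μ hl0 hl1 (convex_ball (0:E) R) Metric.isOpen_ball.measurableSet hz
        (hKc i) (hKm i)
      rw [inter_comm]
      exact this
    calc ∫⁻ y in Metric.ball (0:E) R, ENNReal.ofReal |f ((1 - l) • y + l • z) - f y| ∂μ
        ≤ ∫⁻ y in Metric.ball (0:E) R,
          ENNReal.ofReal (ε * ∑ i ∈ Finset.range N, (D i).indicator (1 : E → ℝ) y) ∂μ := by
          refine lintegral_mono fun y => ENNReal.ofReal_le_ofReal ?_
          rw [eT y]
          simp only [hf]
          rw [add_sub_add_left_eq_sub, ← mul_sub, abs_mul, abs_of_nonneg hε0.le]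
          refine mul_le_mul_of_nonneg_left ?_ hε0.le
          rw [← Finset.sum_sub_distrib]
          refine (Finset.abs_sum_le_sum_abs _ _).trans (Finset.sum_le_sum fun i _ => ?_)
          exact ind_abs fun h => fun h' => h h'.symm
      _ = _ := hlint D hDm
      _ ≤ ENNReal.ofReal ε * ∑ i ∈ Finset.range N,
          ENNReal.ofReal (8 * 2 ^ Module.finrank ℝ E * l) * μ (Metric.ball (0:E) R) := by
          gcongr with i
          exact hDμ i
      _ = _ := by
          have e1 : 2 * M * (8 * 2 ^ Module.finrank ℝ E * l * μ.real (Metric.ball (0:E) R)) =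
              ε * (N * ((8 * 2 ^ Module.finrank ℝ E * l) * μ.real (Metric.ball (0:E) R))) := by
            rw [← hNε]; ring
          rw [Finset.sum_const, Finset.card_range, nsmul_eq_mul, e1,
            ENNReal.ofReal_mul hε0.le, ENNReal.ofReal_mul hN'.le,
            ENNReal.ofReal_mul (p := 8 * 2 ^ Module.finrank ℝ E * l) (by positivity),
            ENNReal.ofReal_natCast, Measure.real,
            ENNReal.ofReal_toReal measure_ball_lt_top.ne]

end DISC

section FIN
variable {E : Type*} [NormedAddCommGroup E] [NormedSpace ℝ E] [FiniteDimensional ℝ E]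
  [MeasurableSpace E] [BorelSpace E] (μ : Measure E) [μ.IsAddHaarMeasure]

lemma F_nullMeas {F : Set E} (hnull : μ (convexHull ℝ F \ F) = 0) : NullMeasurableSet F μ := by
  have h : F = convexHull ℝ F \ (convexHull ℝ F \ F) := by
    rw [sdiff_sdiff_right_self, inter_eq_self_of_subset_right (subset_convexHull ℝ F)]
  rw [h]
  exact (convex_nullMeas μ (convex_convexHull ℝ F)).diff (NullMeasurableSet.of_null hnull)

lemma main_est {R r : ℝ} (hr : 0 < r) (hrR : r ≤ R) (hd : 1 ≤ Module.finrank ℝ E)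
    {F : Set E} (hrF : Metric.ball (0:E) r ⊆ convexHull ℝ F)
    (hR : convexHull ℝ F ⊆ Metric.ball (0:E) R)
    {ψ : E → ℝ} {M σ ς t : ℝ} (hM : 0 < M) (hψ : ∀ y ∈ F, -M ≤ ψ y ∧ ψ y ≤ M)
    (ht0 : 1/2 ≤ t) (ht1 : t ≤ 1) (hσ : 0 ≤ σ)
    (h4 : ∀ y₁ y₂, y₁ ∈ F → y₂ ∈ F →
          t • y₁ + (1 - t) • y₂ ∈ F → (1 - t) • y₁ + t • y₂ ∈ F →
          ψ y₁ + ψ y₂ ≤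
            ψ (t • y₁ + (1 - t) • y₂) + ψ ((1 - t) • y₁ + t • y₂) + σ)
    (hnull : μ (convexHull ℝ F \ F) = 0)
    (hφ : ∫⁻ s, min (μ (convexHull ℝ {y ∈ F | s < ψ y} \ {y ∈ F | s < ψ y}))
      (μ {y ∈ F | s < ψ y}) ≤ ENNReal.ofReal ς) (hς : 0 ≤ ς) (N : ℕ) (hN : 0 < N) (k : ℕ)
    {l : ℝ} (hl : 0 < l) (hl2 : l ≤ 1/2) :
    ∃ Ψ : E → ℝ, ConcaveOn ℝ (convexHull ℝ F) Ψ ∧ (∀ y ∈ convexHull ℝ F, |Ψ y| ≤ M) ∧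
      ∫⁻ y in F, ENNReal.ofReal |Ψ y - ψ y| ∂μ ≤ ENNReal.ofReal (
        (Module.finrank ℝ E + 2) * (k * (σ + 4 * ((l ^ Module.finrank ℝ E)⁻¹ *
          (2 * M / N * μ.real (Metric.ball (0:E) R) + ς) * (μ.real (Metric.ball (0:E) r))⁻¹)) +
          2 * (2 * M * Module.finrank ℝ E / (l * r)) * R * (2*t-1)^k) *
            μ.real (Metric.ball (0:E) R) +
        (2 * M * (8 * 2 ^ Module.finrank ℝ E * l * μ.real (Metric.ball (0:E) R)) +
        (2 * M / N * μ.real (Metric.ball (0:E) R) + ς))) := by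
  have := FiniteDimensional.proper ℝ E
  obtain ⟨f, g, hf, hg, hfM, ⟨M', hgM⟩, hg0, hfψ, hgF, hgi, hreg⟩ :=
    disc_lem μ hR hM hψ hnull hφ hς N hN
  have hΩ := convex_convexHull ℝ F
  set Ω := convexHull ℝ F with hΩdef
  set d := Module.finrank ℝ E with hdd
  set vR := μ.real (Metric.ball (0:E) R) with hvR
  set v0 := μ.real (Metric.ball (0:E) r) with hv0
  set η := 2 * M / N * vR + ς with hη
  have hvR0 : 0 ≤ vR := measureReal_nonneg
  have hv00 : 0 ≤ v0 := measureReal_nonneg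
  have hη0 : 0 ≤ η := by positivity
  have hR0 : 0 ≤ R := hr.le.trans hrR
  have hηi : ∫ x in Metric.ball (0:E) R, g x ∂μ ≤ η := by
    rw [integral_eq_lintegral_of_nonneg_ae (Filter.Eventually.of_forall hg0)
      hg.aestronglyMeasurable]
    exact ENNReal.toReal_le_of_le_ofReal hη0 hgi
  have h4f : ∀ y₁ ∈ Ω, ∀ y₂ ∈ Ω, f y₁ + f y₂ ≤ f (t • y₁ + (1 - t) • y₂)
      + f ((1 - t) • y₁ + t • y₂)
      + σ + (g y₁ + g y₂ + g (t • y₁ + (1 - t) • y₂) + g ((1 - t) • y₁ + t • y₂)) := by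
    intro y₁ hy₁ y₂ hy₂
    have hy₃ : t • y₁ + (1 - t) • y₂ ∈ Ω := hΩ hy₁ hy₂ (by linarith) (by linarith) (by ring)
    have hy₄ : (1 - t) • y₁ + t • y₂ ∈ Ω := hΩ hy₁ hy₂ (by linarith) (by linarith) (by ring)
    have h40 := h4 y₁ y₂
    generalize t • y₁ + (1 - t) • y₂ = y₃ at *
    generalize (1 - t) • y₁ + t • y₂ = y₄ at *
    have a1 := abs_le.1 (hfM y₁)
    have a2 := abs_le.1 (hfM y₂)
    have a3 := abs_le.1 (hfM y₃)
    have a4 := abs_le.1 (hfM y₄)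
    have b1 := hg0 y₁
    have b2 := hg0 y₂
    have b3 := hg0 y₃
    have b4 := hg0 y₄
    by_cases c1 : y₁ ∈ F
    swap
    · have := hgF _ hy₁ c1
      linarith
    by_cases c2 : y₂ ∈ F
    swap
    · have := hgF _ hy₂ c2
      linarith
    by_cases c3 : y₃ ∈ F
    swap
    · have := hgF _ hy₃ c3
      linarith
    by_cases c4 : y₄ ∈ F
    swap
    · have := hgF _ hy₄ c4
      linarith
    have e0 := h40 c1 c2 c3 c4
    have e1 := abs_le.1 (hfψ _ c1)
    have e2 := abs_le.1 (hfψ _ c2)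
    have e3 := abs_le.1 (hfψ _ c3)
    have e4 := abs_le.1 (hfψ _ c4)
    linarith
  have hΛ : 0 ≤ 2 * M * d / (l * r) := by positivity
  obtain ⟨Ψ, hΨ, hΨM, hΨu⟩ := core_lem hΩ hR (u := mol μ f r l) (M := M)
    (σ := σ + 4 * ((l ^ d)⁻¹ * η * v0⁻¹)) (Λ := 2 * M * d / (l * r)) ht0 ht1 (by positivity) hR0 hΛ
    (fun x _ => mol_bound μ hfM hr x)
    (fun y v => (mol_lip μ hf hfM hr hl (by linarith) hd y v).trans (le_of_eq (by
      rw [← hdd]; ring)))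
    (fun y₁ hy₁ y₂ hy₂ => mol_four μ hf hfM hg hgM hg0 hr hl (by linarith) (by linarith) ht1 hΩ hrF
      hR hηi h4f hy₁ hy₂) k
  refine ⟨Ψ, hΨ, hΨM, ?_⟩
  rw [← hdd] at hΨu
  have hq0 : 0 ≤ (2*t-1)^k := pow_nonneg (by linarith) k
  set e := (d + 2 : ℝ) * (k * (σ + 4 * ((l ^ d)⁻¹ * η * v0⁻¹)) +
    2 * (2 * M * d / (l * r)) * R * (2*t-1)^k) with he
  have he0 : 0 ≤ e := by positivity
  have hFm := F_nullMeas μ hnull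
  have hFR : F ⊆ Metric.ball (0:E) R := (subset_convexHull ℝ F).trans hR
  calc ∫⁻ y in F, ENNReal.ofReal |Ψ y - ψ y| ∂μ
      ≤ ∫⁻ y in F, (ENNReal.ofReal e + (ENNReal.ofReal |mol μ f r l y - f y| +
          ENNReal.ofReal (g y))) ∂μ := by
        refine lintegral_mono_ae ?_
        filter_upwards [ae_restrict_mem₀ hFm] with y hy
        rw [← ENNReal.ofReal_add (abs_nonneg _) (hg0 y), ← ENNReal.ofReal_add he0
          (add_nonneg (abs_nonneg _) (hg0 y))]
        refine ENNReal.ofReal_le_ofReal ?_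
        have h1 := hΨu y (subset_convexHull ℝ F hy)
        have h2 := hfψ y hy
        calc |Ψ y - ψ y| = |(Ψ y - mol μ f r l y) + ((mol μ f r l y - f y) + (f y - ψ y))| := by
              congr 1; ring
          _ ≤ |Ψ y - mol μ f r l y| + (|mol μ f r l y - f y| + |f y - ψ y|) :=
              (abs_add_le _ _).trans (add_le_add le_rfl (abs_add_le _ _))
          _ ≤ _ := by gcongr
    _ ≤ ∫⁻ y in Metric.ball (0:E) R, (ENNReal.ofReal e + (ENNReal.ofReal |mol μ f r l y - f y| +
          ENNReal.ofReal (g y))) ∂μ := lintegral_mono_set hFR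
    _ = ENNReal.ofReal e * μ (Metric.ball (0:E) R) +
        ((∫⁻ y in Metric.ball (0:E) R, ENNReal.ofReal |mol μ f r l y - f y| ∂μ) +
          ∫⁻ y in Metric.ball (0:E) R, ENNReal.ofReal (g y) ∂μ) := by
        rw [lintegral_add_left measurable_const, lintegral_add_right _ hg.ennreal_ofReal,
          setLIntegral_const]
    _ ≤ ENNReal.ofReal e * ENNReal.ofReal vR +
        (ENNReal.ofReal (2 * M * (8 * 2 ^ d * l * vR)) + ENNReal.ofReal η) := by
        gcongr
        · rw [hvR, Measure.real, ENNReal.ofReal_toReal measure_ball_lt_top.ne]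
        · exact mol_L1 μ hf hfM hr hrR (hreg l hl hl2)
    _ = _ := by
        rw [← ENNReal.ofReal_mul he0, ← ENNReal.ofReal_add (by positivity) hη0,
          ← ENNReal.ofReal_add (by positivity) (by positivity)]

lemma null_step {F : Set E} {ψ : E → ℝ} {M ς : ℝ} (hψ : ∀ y ∈ F, -M ≤ ψ y)
    (hφ : ∫⁻ s, min (μ (convexHull ℝ {y ∈ F | s < ψ y} \ {y ∈ F | s < ψ y}))
      (μ {y ∈ F | s < ψ y}) ≤ ENNReal.ofReal ς) : μ (convexHull ℝ F \ F) = 0 ∨ μ F = 0 := by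
  by_contra! hc
  have hm : min (μ (convexHull ℝ F \ F)) (μ F) ≠ 0 := by
    rcases min_choice (μ (convexHull ℝ F \ F)) (μ F) with h | h <;> rw [h]
    exacts [hc.1, hc.2]
  have h1 : ∫⁻ s in Iio (-M), min (μ (convexHull ℝ F \ F)) (μ F) ≤ ENNReal.ofReal ς := by
    refine le_trans ?_ hφ
    refine le_trans ?_ (setLIntegral_le_lintegral (Iio (-M)) _)
    refine setLIntegral_mono' measurableSet_Iio fun s hs => ?_
    have : {y ∈ F | s < ψ y} = F := by
      ext y
      exact ⟨fun h => h.1, fun h => ⟨h, lt_of_lt_of_le hs (hψ y h)⟩⟩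
    rw [this]
  rw [setLIntegral_const, Real.volume_Iio, ENNReal.mul_top hm] at h1
  exact absurd h1 (by simp)

lemma phi_step {F : Set E} {ψ : E → ℝ} {ς : ℝ} (H : Set ℝ)
    (hH : (∫⁻ s in H, μ (convexHull ℝ {y ∈ F | s < ψ y} \ {y ∈ F | s < ψ y})) +
          (∫⁻ s in Hᶜ, μ {y ∈ F | s < ψ y}) ≤ ENNReal.ofReal ς) :
    ∫⁻ s, min (μ (convexHull ℝ {y ∈ F | s < ψ y} \ {y ∈ F | s < ψ y}))
      (μ {y ∈ F | s < ψ y}) ≤ ENNReal.ofReal ς := by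
  refine le_trans ?_ hH
  rw [← setLIntegral_univ, ← union_compl_self H]
  refine (lintegral_union_le _ _ _).trans ?_
  gcongr
  · exact min_le_left _ _
  · exact min_le_right _ _

end FIN

set_option maxHeartbeats 2000000 in
lemma num_lem {d : ℕ} (hd : 1 ≤ d) {vR v0 r R : ℝ} (hvR : 0 ≤ vR) (hv0 : 0 < v0) (hr : 0 < r)
    (hR : 0 ≤ R) {τ t σ ς M : ℝ} (hτ : 0 < τ) (hτ2 : τ ≤ 1/2) (ht0 : 1/2 ≤ t) (ht1 : t ≤ 1 - τ/2)
    (hσ : 0 < σ) (hς : 0 < ς) (hM : 1 ≤ M) (hδ1 : σ + ς ≤ 1) :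
    ∃ (N k : ℕ) (l : ℝ), 0 < N ∧ 0 < l ∧ l ≤ 1/2 ∧
      (d + 2 : ℝ) * (k * (σ + 4 * ((l ^ d)⁻¹ * (2 * M / N * vR + ς) * v0⁻¹)) +
          2 * (2 * M * d / (l * r)) * R * (2*t-1)^k) * vR +
        (2 * M * (8 * 2 ^ d * l * vR) + (2 * M / N * vR + ς)) ≤
      (((d + 2 : ℝ) * (4 + 16 * 2 ^ d * (vR + 1) * v0⁻¹ + 8 * d * R / r) * vR + 8 * 2 ^ d * vR
        + (vR + 1)) / τ) * M * (σ + ς) ^ (1 / (4 * d : ℝ)) := by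
  set δ := σ + ς with hδ
  have hδ0 : 0 < δ := by positivity
  set p := δ ^ (1 / (4 * d : ℝ)) with hp
  have hd0 : (0:ℝ) < d := by exact_mod_cast hd
  have hp0 : 0 < p := Real.rpow_pos_of_pos hδ0 _
  have hp1 : p ≤ 1 := Real.rpow_le_one hδ0.le hδ1 (by positivity)
  set P := p ^ d with hP
  have hP0 : 0 < P := by positivity
  have hPp : P ≤ p := pow_le_of_le_one hp0.le hp1 (by omega)
  have hP1 : P ≤ 1 := hPp.trans hp1
  have hδP : δ = P ^ 4 := by
    rw [hP, ← pow_mul, hp, ← Real.rpow_natCast, ← Real.rpow_mul hδ0.le]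
    have : 1 / (4 * d : ℝ) * ((d * 4 : ℕ) : ℝ) = 1 := by push_cast; field_simp
    rw [this, Real.rpow_one]
  have hP4 : P ^ 4 ≤ p := (pow_le_of_le_one hP0.le hP1 (by norm_num)).trans hPp
  obtain ⟨N, hN⟩ := exists_nat_gt (2 / δ)
  have hN0 : (0:ℝ) < N := lt_trans (by positivity) hN
  set k := ⌈(-Real.log δ) / τ⌉₊ with hk
  have hlog : -Real.log δ ≤ 4 * (1 / P - 1) := by
    have := Real.log_le_sub_one_of_pos (x := 1 / P) (by positivity)
    rw [Real.log_div one_ne_zero hP0.ne', Real.log_one] at this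
    rw [hδP, Real.log_pow]; push_cast; linarith
  have hlog0 : 0 ≤ -Real.log δ := by
    have := Real.log_nonpos hδ0.le hδ1
    linarith
  have hkle : (k:ℝ) ≤ 4 / (τ * P) := by
    have h1 := (Nat.ceil_lt_add_one (div_nonneg hlog0 hτ.le)).le
    have h2 : (-Real.log δ) / τ ≤ 4 * (1 / P - 1) / τ := by gcongr
    have h3 : 4 * (1 / P - 1) / τ + 1 = 4 / (τ * P) - (4 / τ - 1) := by field_simp; ring
    have h4 : 1 ≤ 4 / τ := by rw [le_div_iff₀ hτ]; linarith
    linarith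
  have hq : (2*t-1)^k ≤ P ^ 4 := by
    rw [← hδP]
    calc (2*t-1)^k ≤ (Real.exp (-τ)) ^ k := by
          refine pow_le_pow_left₀ (by linarith) ?_ k
          have := Real.add_one_le_exp (-τ)
          linarith
      _ = Real.exp (-(k * τ)) := by rw [← Real.exp_nat_mul]; congr 1; ring
      _ ≤ Real.exp (Real.log δ) := by
          refine Real.exp_le_exp.2 ?_
          have := Nat.le_ceil ((-Real.log δ) / τ)
          rw [div_le_iff₀ hτ] at this
          linarith
      _ = δ := Real.exp_log hδ0
  have hM0 : 0 < M := by linarith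
  have hη : 2 * M / N * vR + ς ≤ (vR + 1) * M * P ^ 4 := by
    rw [← hδP]
    have h1 : 2 * M / N ≤ M * δ := by
      rw [div_le_iff₀ hN0]
      rw [div_lt_iff₀ hδ0] at hN
      nlinarith
    have h2 : ς ≤ M * δ := by nlinarith
    nlinarith [mul_le_mul_of_nonneg_right h1 hvR]
  have hη0 : 0 ≤ 2 * M / N * vR + ς := by positivity
  have hq0 : 0 ≤ (2*t-1)^k := pow_nonneg (by linarith) k
  refine ⟨N, k, p / 2, by exact_mod_cast hN0, by positivity, by linarith, ?_⟩
  generalize (2 * M / N * vR + ς) = η at *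
  generalize (2*t-1)^k = q at *
  have hτ1 : 1 ≤ 1 / τ := by rw [le_div_iff₀ hτ]; linarith
  have hMp : 0 < M * p := by positivity
  have e1 : k * σ ≤ 4 * (M * p / τ) := by
    calc k * σ ≤ 4 / (τ * P) * P ^ 4 := by
          have : σ ≤ P ^ 4 := by rw [← hδP]; linarith
          gcongr
      _ = 4 * (P ^ 3 / τ) := by field_simp
      _ ≤ 4 * (M * p / τ) := by
          have h3 : P ^ 3 ≤ M * p := by
            have : P ^ 3 ≤ p := (pow_le_of_le_one hP0.le hP1 (by norm_num)).trans hPp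
            nlinarith
          gcongr
  have e2 : k * (4 * (((p/2) ^ d)⁻¹ * η * v0⁻¹)) ≤
      16 * 2 ^ d * (vR + 1) * v0⁻¹ * (M * p / τ) := by
    calc k * (4 * (((p/2) ^ d)⁻¹ * η * v0⁻¹))
        ≤ 4 / (τ * P) * (4 * (((p/2) ^ d)⁻¹ * ((vR + 1) * M * P ^ 4) * v0⁻¹)) := by gcongr
      _ = 16 * 2 ^ d * (vR + 1) * v0⁻¹ * (M * P ^ 2 / τ) := by
          rw [div_pow, ← hP]; field_simp; ring
      _ ≤ _ := by
          have : P ^ 2 ≤ p := (pow_le_of_le_one hP0.le hP1 (by norm_num)).trans hPp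
          gcongr
  have e3 : 2 * (2 * M * d / (p / 2 * r)) * R * q ≤ 8 * d * R / r * (M * p / τ) := by
    calc 2 * (2 * M * d / (p / 2 * r)) * R * q ≤ 2 * (2 * M * d / (p / 2 * r)) * R * (p ^ 2) := by
          have : P ^ 4 ≤ p ^ 2 := by
            calc P ^ 4 ≤ P ^ 2 := pow_le_pow_of_le_one hP0.le hP1 (by norm_num)
              _ ≤ p ^ 2 := by gcongr
          have := hq.trans this
          gcongr
      _ = 8 * d * R / r * (M * p) := by field_simp; ring
      _ ≤ _ := by
          have : M * p ≤ M * p / τ := by rw [le_div_iff₀ hτ]; nlinarith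
          gcongr
  have hX : M * p ≤ M * p / τ := by rw [le_div_iff₀ hτ]; nlinarith
  have e4 : η ≤ (vR + 1) * (M * p / τ) := by
    calc η ≤ (vR + 1) * M * P ^ 4 := hη
      _ ≤ (vR + 1) * M * p := by gcongr
      _ = (vR + 1) * (M * p) := by ring
      _ ≤ _ := by gcongr
  have e5 : 2 * M * (8 * 2 ^ d * (p/2) * vR) ≤ 8 * 2 ^ d * vR * (M * p / τ) := by
    calc _ = 8 * 2 ^ d * vR * (M * p) := by ring
      _ ≤ _ := by gcongr
  calc _ = (d + 2 : ℝ) * (k * σ + k * (4 * (((p/2) ^ d)⁻¹ * η * v0⁻¹)) +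
        2 * (2 * M * d / (p / 2 * r)) * R * q) * vR +
          (2 * M * (8 * 2 ^ d * (p/2) * vR) + η) := by ring
    _ ≤ (d + 2 : ℝ) * (4 * (M * p / τ) + 16 * 2 ^ d * (vR + 1) * v0⁻¹ * (M * p / τ) +
        8 * d * R / r * (M * p / τ)) * vR + (8 * 2 ^ d * vR * (M * p / τ) +
          (vR + 1) * (M * p / τ)) := by gcongr
    _ = _ := by ring

set_option maxHeartbeats 2000000 in
/-- Lemma on closeness to a concave function: if `ψ : F → ℝ` is
`σ`-almost concave along `(t', t'')`-combinations, `F` almost fills its convex hull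
`Ω` (which is comparable to a unit ball), `ψ` is bounded by `M̂`, and most superlevel
sets of `ψ` are close to their convex hulls, then `ψ` is `L¹`-close on `F` to a concave
function `Ψ : Ω → [-2M̂, 2M̂]`, with error `τ^{-L'ₙ} M̂ (σ + ς)^{β_{n,τ}}`,
`β_{n,τ} = τ / (16(n-1)|log τ|)`. -/
theorem statement12 (n : ℕ) (hn : 2 ≤ n) :
    ∃ L : ℝ,
      ∀ (τ t' σ ς M r : ℝ) (F : Set (EuclideanSpace ℝ (Fin (n - 1))))
        (ψ : EuclideanSpace ℝ (Fin (n - 1)) → ℝ),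
        0 < τ → τ ≤ 1 / 2 → 1 / 2 ≤ t' → t' ≤ 1 - τ / 2 →
        0 < σ → 0 < ς → 1 ≤ M →
        (∀ y₁ y₂, y₁ ∈ F → y₂ ∈ F →
          t' • y₁ + (1 - t') • y₂ ∈ F → (1 - t') • y₁ + t' • y₂ ∈ F →
          ψ y₁ + ψ y₂ ≤
            ψ (t' • y₁ + (1 - t') • y₂) + ψ ((1 - t') • y₁ + t' • y₂) + σ) →
        volume (convexHull ℝ F \ F) ≤ ENNReal.ofReal ς →
        1 / (n : ℝ) < r → r < n →
        Metric.ball 0 r ⊆ convexHull ℝ F →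
        convexHull ℝ F ⊆ Metric.ball 0 (((n : ℝ) - 1) * r) →
        (∀ y ∈ F, -M ≤ ψ y ∧ ψ y ≤ M) →
        (∃ H : Set ℝ,
          (∫⁻ s in H,
            volume (convexHull ℝ {y ∈ F | s < ψ y} \ {y ∈ F | s < ψ y})) +
          (∫⁻ s in Hᶜ, volume {y ∈ F | s < ψ y}) ≤ ENNReal.ofReal ς) →
        ∃ Ψ : EuclideanSpace ℝ (Fin (n - 1)) → ℝ,
          ConcaveOn ℝ (convexHull ℝ F) Ψ ∧
          (∀ y ∈ convexHull ℝ F, -(2 * M) ≤ Ψ y ∧ Ψ y ≤ 2 * M) ∧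
          (∫⁻ y in F, ENNReal.ofReal |Ψ y - ψ y|) ≤
            ENNReal.ofReal (τ ^ (-L) * M *
              (σ + ς) ^ (τ / (16 * ((n : ℝ) - 1) * |Real.log τ|))) := by
  have hn1 : 1 ≤ n - 1 := by omega
  have hnR : (2:ℝ) ≤ n := by exact_mod_cast hn
  have hncast : ((n - 1 : ℕ) : ℝ) = (n : ℝ) - 1 := by
    rw [Nat.cast_sub (by omega)]; simp
  set d := n - 1 with hd
  have hfr : Module.finrank ℝ (EuclideanSpace ℝ (Fin d)) = d := finrank_euclideanSpace_fin
  set R : ℝ := (n:ℝ) ^ 2 with hR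
  set r0 : ℝ := 1 / (n:ℝ) with hr0
  have hr0p : 0 < r0 := by positivity
  have hRp : 0 < R := by positivity
  have hr0R : r0 ≤ R := by
    have h1 : r0 ≤ 1 := by rw [hr0, div_le_one (by linarith)]; linarith
    have h2 : 1 ≤ R := by rw [hR]; nlinarith
    linarith
  set vR := volume.real (Metric.ball (0 : EuclideanSpace ℝ (Fin d)) R) with hvR
  set v0 := volume.real (Metric.ball (0 : EuclideanSpace ℝ (Fin d)) r0) with hv0
  have hvRp : 0 < vR := real_ball_pos volume 0 hRp
  have hv0p : 0 < v0 := real_ball_pos volume 0 hr0p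
  set C : ℝ := (d + 2 : ℝ) * (4 + 16 * 2 ^ d * (vR + 1) * v0⁻¹ + 8 * d * R / r0) * vR
    + 8 * 2 ^ d * vR + (vR + 1) with hC
  have hCv : vR + 1 ≤ C := by
    have : 0 ≤ (d + 2 : ℝ) * (4 + 16 * 2 ^ d * (vR + 1) * v0⁻¹ + 8 * d * R / r0) * vR
      + 8 * 2 ^ d * vR := by positivity
    linarith
  have hC1 : 1 ≤ C := by linarith
  refine ⟨1 + Real.logb 2 C, ?_⟩
  intro τ t σ ς M r F ψ hτ hτ2 ht0 ht1 hσ hς hM h4 _ hr1 hr2 hrF hRF hψ hH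
  have hM0 : 0 < M := by linarith
  have hL0 : 0 ≤ Real.logb 2 C := Real.logb_nonneg (by norm_num) hC1
  have hτinv : 2 ≤ τ⁻¹ := by
    rw [le_inv_comm₀ (by norm_num) hτ]; linarith
  have hCτ : C / τ ≤ τ ^ (-(1 + Real.logb 2 C)) := by
    rw [Real.rpow_neg hτ.le, ← Real.inv_rpow hτ.le, Real.rpow_add (by positivity), Real.rpow_one,
      div_eq_inv_mul]
    refine mul_le_mul_of_nonneg_left ?_ (by positivity)
    calc C = 2 ^ (Real.logb 2 C) := (Real.rpow_logb (by norm_num) (by norm_num) (by linarith)).symm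
      _ ≤ _ := Real.rpow_le_rpow (by norm_num) hτinv hL0
  have hCτ1 : C ≤ C / τ := by
    rw [le_div_iff₀ hτ]; nlinarith
  have hrF' : Metric.ball 0 r0 ⊆ convexHull ℝ F := (Metric.ball_subset_ball hr1.le).trans hrF
  have hRF' : convexHull ℝ F ⊆ Metric.ball 0 R := by
    refine hRF.trans (Metric.ball_subset_ball ?_)
    rw [hR]; nlinarith
  obtain ⟨H, hH⟩ := hH
  have hφ := phi_step volume H hH
  have hzc : ConcaveOn ℝ (convexHull ℝ F) (fun _ => (0:ℝ)) :=
    concaveOn_const 0 (convex_convexHull ℝ F)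
  by_cases hF0 : volume F = 0
  · refine ⟨fun _ => 0, hzc, fun y _ => ⟨by linarith, by linarith⟩, ?_⟩
    rw [Measure.restrict_eq_zero.2 hF0]
    simp
  have hnull : volume (convexHull ℝ F \ F) = 0 :=
    (null_step volume (fun y hy => (hψ y hy).1) hφ).resolve_right hF0
  have hlog : 1/2 ≤ |Real.log τ| := by
    have h1 : Real.log τ ≤ Real.log (1/2) := Real.log_le_log hτ hτ2
    have h2 := Real.log_two_gt_d9
    rw [one_div, Real.log_inv] at h1
    rw [abs_of_nonpos (by linarith)]
    linarith
  have hδ0 : 0 < σ + ς := by positivity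
  have hdp : (1:ℝ) ≤ (n:ℝ) - 1 := by linarith
  set β := τ / (16 * ((n : ℝ) - 1) * |Real.log τ|) with hβ
  have hβ0 : 0 ≤ β := by positivity
  by_cases hδ1 : σ + ς ≤ 1
  swap
  · refine ⟨fun _ => 0, hzc, fun y _ => ⟨by linarith, by linarith⟩, ?_⟩
    have hδβ : 1 ≤ (σ + ς) ^ β := Real.one_le_rpow (by linarith) hβ0
    calc ∫⁻ y in F, ENNReal.ofReal |0 - ψ y| ≤ ∫⁻ y in F, ENNReal.ofReal M := by
          refine lintegral_mono_ae ?_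
          filter_upwards [ae_restrict_mem₀ (F_nullMeas volume hnull)] with y hy
          refine ENNReal.ofReal_le_ofReal ?_
          rw [zero_sub, abs_neg]
          exact abs_le.2 (hψ y hy)
      _ = ENNReal.ofReal M * volume F := setLIntegral_const _ _
      _ ≤ ENNReal.ofReal M * volume (Metric.ball (0 : EuclideanSpace ℝ (Fin d)) R) := by
          gcongr
          exact (subset_convexHull ℝ F).trans hRF'
      _ = ENNReal.ofReal (M * vR) := by
          rw [ENNReal.ofReal_mul hM0.le, hvR, Measure.real,
            ENNReal.ofReal_toReal measure_ball_lt_top.ne]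
      _ ≤ _ := by
          refine ENNReal.ofReal_le_ofReal ?_
          have h1 : vR ≤ τ ^ (-(1 + Real.logb 2 C)) := by linarith
          calc M * vR = vR * M * 1 := by ring
            _ ≤ _ := by gcongr
  · obtain ⟨N, k, l, hN, hl, hl2, hnum⟩ := num_lem hn1 hvRp.le hv0p hr0p hRp.le hτ hτ2 ht0 ht1 hσ hς
      hM hδ1
    obtain ⟨Ψ, h1, h2, h3⟩ := main_est volume hr0p hr0R (by rw [hfr]; exact hn1) hrF' hRF' hM0 hψ
      ht0 (by linarith) hσ.le h4 hnull hφ hς.le N hN k hl hl2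
    refine ⟨Ψ, h1, fun y hy => ?_, h3.trans (ENNReal.ofReal_le_ofReal ?_)⟩
    · have := abs_le.1 (h2 y hy)
      exact ⟨by linarith, by linarith⟩
    · rw [hfr]
      refine hnum.trans ?_
      have h5 : (σ + ς) ^ (1 / (4 * (d:ℝ))) ≤ (σ + ς) ^ β := by
        refine Real.rpow_le_rpow_of_exponent_ge hδ0 hδ1 ?_
        rw [hβ, hncast, div_le_div_iff₀ (by positivity) (by positivity)]
        have h6 : τ ≤ 4 * |Real.log τ| := by linarith
        have h7 := mul_le_mul_of_nonneg_right h6 (by linarith : 0 ≤ 4 * ((n:ℝ) - 1))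
        linarith
      calc _ ≤ τ ^ (-(1 + Real.logb 2 C)) * M * (σ + ς) ^ (1 / (4 * (d:ℝ))) := by gcongr
        _ ≤ _ := by gcongr
end

section
/- Let 0 < τ ≤ 1/2 and t ∈ [τ, 1 − τ], let F ⊆ ℝ^{n−1}, and let f, g : F → ℝ be bounded Borel functions satisfying t f(y') + (1 − t) g(y'') ≤ t f(y) + (1 − t) g(y) + σ for some σ ≥ 0, whenever y = ty' + (1 − t)y'' and y, y', y'' ∈ F. Define t' := 1/(2 − t) and t'' := 1 − t', and for y₁, y₂ ∈ ℝ^{n−1} set y₁₂' := t'y₁ + (1 − t')y₂ and y₁₂'' := t''y₁ + (1 − t'')y₂. Then, whenever y₁, y₂, y₁₂', y₁₂'' ∈ F, one has f(y₁) + f(y₂) ≤ f(y₁₂') + f(y₁₂'') + (2/t) σ. Moreover, if τ ≤ t ≤ 1/2 then 1/2 ≤ t' ≤ 2/3, while if 1/2 ≤ t ≤ 1 − τ then 2/3 ≤ t' ≤ 1 − τ/2. -/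
open MeasureTheory Set

/-- Remark on 3-point vs 4-point inequalities: if bounded Borel
functions `f, g` on `F ⊆ ℝ^{n-1}` satisfy the 3-point concavity inequality
`t f(y') + (1-t) g(y'') ≤ [t f + (1-t) g](ty' + (1-t)y'') + σ`, then with
`t' = 1/(2-t)`, `t'' = 1 - t'` the function `f` satisfies the 4-point inequality
`f(y₁) + f(y₂) ≤ f(y₁₂') + f(y₁₂'') + (2/t)σ`; moreover `1/2 ≤ t' ≤ 2/3` whenever
`τ ≤ t ≤ 1/2`, and `2/3 ≤ t' ≤ 1 - τ/2` whenever `1/2 ≤ t ≤ 1 - τ`. -/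
theorem statement14 (n : ℕ) (τ t σ : ℝ) (hτ : 0 < τ) (hτ' : τ ≤ 1 / 2)
    (ht : t ∈ Set.Icc τ (1 - τ)) (hσ : 0 ≤ σ)
    (F : Set (EuclideanSpace ℝ (Fin (n - 1))))
    (f g : EuclideanSpace ℝ (Fin (n - 1)) → ℝ)
    (hfm : Measurable f) (hgm : Measurable g)
    (hfb : ∃ C : ℝ, ∀ y ∈ F, |f y| ≤ C) (hgb : ∃ C : ℝ, ∀ y ∈ F, |g y| ≤ C)
    (h3 : ∀ y' y'', y' ∈ F → y'' ∈ F → t • y' + (1 - t) • y'' ∈ F →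
      t * f y' + (1 - t) * g y'' ≤
        t * f (t • y' + (1 - t) • y'') + (1 - t) * g (t • y' + (1 - t) • y'') + σ) :
    (∀ y₁ y₂, y₁ ∈ F → y₂ ∈ F →
      (1 / (2 - t)) • y₁ + (1 - 1 / (2 - t)) • y₂ ∈ F →
      (1 - 1 / (2 - t)) • y₁ + (1 / (2 - t)) • y₂ ∈ F →
      f y₁ + f y₂ ≤
        f ((1 / (2 - t)) • y₁ + (1 - 1 / (2 - t)) • y₂) +
          f ((1 - 1 / (2 - t)) • y₁ + (1 / (2 - t)) • y₂) + (2 / t) * σ) ∧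
    (t ≤ 1 / 2 → 1 / 2 ≤ 1 / (2 - t) ∧ 1 / (2 - t) ≤ 2 / 3) ∧
    (1 / 2 ≤ t → 2 / 3 ≤ 1 / (2 - t) ∧ 1 / (2 - t) ≤ 1 - τ / 2) := by
  obtain ⟨h1, h2⟩ := ht
  have htp : 0 < t := by linarith
  have hp : 0 < 2 - t := by linarith
  refine ⟨?_, ?_, ?_⟩
  · intro y₁ y₂ hy₁ hy₂ ha hb
    have c1 : t + (1 - t) * (1 - 1 / (2 - t)) = 1 / (2 - t) := by
      field_simp
      ring
    have c2 : (1 - t) * (1 / (2 - t)) = 1 - 1 / (2 - t) := by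
      field_simp
      ring
    generalize 1 / (2 - t) = s at *
    have e1 : t • y₁ + (1 - t) • ((1 - s) • y₁ + s • y₂) = s • y₁ + (1 - s) • y₂ := by
      rw [smul_add, smul_smul, smul_smul, c2]
      have : s • y₁ = t • y₁ + ((1 - t) * (1 - s)) • y₁ := by rw [← add_smul, c1]
      rw [this]
      abel
    have e2 : t • y₂ + (1 - t) • (s • y₁ + (1 - s) • y₂) = (1 - s) • y₁ + s • y₂ := by
      rw [smul_add, smul_smul, smul_smul, c2]
      have : s • y₂ = t • y₂ + ((1 - t) * (1 - s)) • y₂ := by rw [← add_smul, c1]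
      rw [this]
      abel
    have i1 := h3 y₁ _ hy₁ hb (by rw [e1]; exact ha)
    have i2 := h3 y₂ _ hy₂ ha (by rw [e2]; exact hb)
    rw [e1] at i1
    rw [e2] at i2
    have e : t * (2 / t * σ) = 2 * σ := by field_simp
    refine le_of_mul_le_mul_left ?_ htp
    linarith
  · intro h
    constructor
    · rw [div_le_div_iff₀ (by norm_num) hp]; linarith
    · rw [div_le_div_iff₀ hp (by norm_num)]; linarith
  · intro h
    constructor
    · rw [div_le_div_iff₀ (by norm_num) hp]; linarith
    · rw [div_le_iff₀ hp]; nlinarith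
end
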